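/- arXiv:2509.09652 — 10 statements merged into one kernel-verified Lean document; each statement's English description precedes it below -/
import Mathlib

section
/- Let n, k ≥ 1 and let d : Fin n → Fin n → ℝ be symmetric with d i j ≥ 0 and d i i = 0. If an embedding x : Fin n → EuclideanSpace ℝ (Fin k) satisfies EMV(d,x) ≤ 2·D₂(d), then there exists an index a ∈ Fin n such that (1/n)·∑_{i ∈ Fin n} ‖x i − x a‖² ≤ 6·D₂(d). -/
/-- If an embedding `x` has EMV objective at most `2·D₂(d)`, then some
anchor index `a` satisfies `(1/n)·∑ᵢ ‖x i − x a‖² ≤ 6·D₂(d)`. -/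
theorem stmt_0 (n k : ℕ) (hn : 1 ≤ n) (hk : 1 ≤ k)
    (d : Fin n → Fin n → ℝ)
    (hsymm : ∀ i j, d i j = d j i)
    (hnonneg : ∀ i j, 0 ≤ d i j)
    (hdiag : ∀ i, d i i = 0)
    (x : Fin n → EuclideanSpace ℝ (Fin k))
    (hEMV : (1 / (n : ℝ) ^ 2) * ∑ i, ∑ j, (d i j - ‖x i - x j‖) ^ 2
      ≤ 2 * ((1 / (n : ℝ) ^ 2) * ∑ i, ∑ j, d i j ^ 2)) :
    ∃ a : Fin n, (1 / (n : ℝ)) * ∑ i, ‖x i - x a‖ ^ 2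
      ≤ 6 * ((1 / (n : ℝ) ^ 2) * ∑ i, ∑ j, d i j ^ 2) := by
  have hn0 : (0 : ℝ) < n := by exact_mod_cast hn
  haveI : Nonempty (Fin n) := ⟨⟨0, hn⟩⟩
  have hE : ∑ i, ∑ j, (d i j - ‖x i - x j‖) ^ 2 ≤ 2 * ∑ i, ∑ j, d i j ^ 2 := by
    have hp : (0 : ℝ) < 1 / (n : ℝ) ^ 2 := by positivity
    refine le_of_mul_le_mul_left ?_ hp
    linarith
  have hD : 0 ≤ ∑ i, ∑ j, d i j ^ 2 :=
    Finset.sum_nonneg fun i _ => Finset.sum_nonneg fun j _ => sq_nonneg _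
  have hpt : ∑ a, ∑ i, ‖x i - x a‖ ^ 2
      ≤ 5 / 2 * ∑ i, ∑ j, d i j ^ 2
        + 5 / 3 * ∑ i, ∑ j, (d i j - ‖x i - x j‖) ^ 2 := by
    rw [Finset.sum_comm]
    simp only [Finset.mul_sum, ← Finset.sum_add_distrib]
    refine Finset.sum_le_sum fun i _ => Finset.sum_le_sum fun j _ => ?_
    nlinarith [sq_nonneg (5 * d i j - 2 * ‖x i - x j‖)]
  have hS : ∑ a, ∑ i, ‖x i - x a‖ ^ 2
      ≤ ∑ _a : Fin n, (6 / (n : ℝ)) * ∑ i, ∑ j, d i j ^ 2 := by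
    rw [Finset.sum_const, Finset.card_univ, Fintype.card_fin, nsmul_eq_mul]
    have : (n : ℝ) * (6 / (n : ℝ) * ∑ i, ∑ j, d i j ^ 2) = 6 * ∑ i, ∑ j, d i j ^ 2 := by
      field_simp
    rw [this]
    linarith
  obtain ⟨a, -, ha⟩ := Finset.exists_le_of_sum_le Finset.univ_nonempty hS
  refine ⟨a, ?_⟩
  calc (1 / (n : ℝ)) * ∑ i, ‖x i - x a‖ ^ 2
      ≤ (1 / (n : ℝ)) * ((6 / (n : ℝ)) * ∑ i, ∑ j, d i j ^ 2) := by gcongr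
    _ = 6 * ((1 / (n : ℝ) ^ 2) * ∑ i, ∑ j, d i j ^ 2) := by
      field_simp
end

section
/- There is an absolute constant C ≥ 1 such that the following holds. Let n, k ≥ 1, Δ ≥ 1, 0 < ε < 1, and let d be a distance input on n points with 1 ≤ d i j ≤ Δ for all i ≠ j. Then there exists an embedding x : Fin n → EuclideanSpace ℝ (Fin k) with EMV(d,x) ≤ OPT_EMV(d) + ε·D₂(d) and with diameter bound ‖x i − x j‖ ≤ C·(Δ/ε)^C for all i, j ∈ Fin n. -/
/-- The k-EMV (Euclidean Metric Violation) objective. -/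
noncomputable def EMV (n k : ℕ) (d : Fin n → Fin n → ℝ)
    (x : Fin n → EuclideanSpace ℝ (Fin k)) : ℝ :=
  (1 / (n : ℝ) ^ 2) * ∑ i, ∑ j, (d i j - ‖x i - x j‖) ^ 2

/-- D₂(d) = average of squared distances. -/
noncomputable def D2 (n : ℕ) (d : Fin n → Fin n → ℝ) : ℝ :=
  (1 / (n : ℝ) ^ 2) * ∑ i, ∑ j, d i j ^ 2

/-- The optimum value of the k-EMV objective. -/
noncomputable def OPTEMV (n k : ℕ) (d : Fin n → Fin n → ℝ) : ℝ :=
  sInf {y | ∃ x : Fin n → EuclideanSpace ℝ (Fin k), y = EMV n k d x}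

lemma reduce_diam (n k : ℕ) (hn : 1 ≤ n) (Δ : ℝ) (hΔ : 1 ≤ Δ) (d : Fin n → Fin n → ℝ)
    (hsym : ∀ i j, d i j = d j i) (h0 : ∀ i j, 0 ≤ d i j) (hd : ∀ i j, d i j ≤ Δ)
    (x : Fin n → EuclideanSpace ℝ (Fin k))
    (hx : ∑ i, ∑ j, (d i j - ‖x i - x j‖) ^ 2 ≤ 2 * (n : ℝ) ^ 2 * Δ ^ 2) :
    ∃ y : Fin n → EuclideanSpace ℝ (Fin k),
      ∑ i, ∑ j, (d i j - ‖y i - y j‖) ^ 2 ≤ ∑ i, ∑ j, (d i j - ‖x i - x j‖) ^ 2 ∧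
      ∀ i j, ‖y i - y j‖ ≤ 16 * Δ := by
  have hnpos : (0 : ℝ) < n := by exact_mod_cast hn
  have : Nonempty (Fin n) := ⟨⟨0, hn⟩⟩
  have hdsq : ∀ i j, d i j ^ 2 ≤ Δ ^ 2 := fun i j => by
    have := h0 i j; have := hd i j; gcongr
  have htot : ∑ i, ∑ j, ‖x j - x i‖ ^ 2 ≤ ∑ _i : Fin n, 6 * (n : ℝ) * Δ ^ 2 := by
    have h1 : ∑ i, ∑ j, ‖x j - x i‖ ^ 2
        ≤ ∑ i, ∑ j, (2 * (d i j - ‖x i - x j‖) ^ 2 + 2 * Δ ^ 2) := by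
      refine Finset.sum_le_sum fun i _ => Finset.sum_le_sum fun j _ => ?_
      rw [norm_sub_rev]
      nlinarith [hdsq i j, sq_nonneg (2 * d i j - ‖x i - x j‖)]
    simp only [Finset.sum_add_distrib, ← Finset.mul_sum, Finset.sum_const, Finset.card_univ,
      Fintype.card_fin, nsmul_eq_mul] at h1 ⊢
    nlinarith
  obtain ⟨c, -, hc⟩ := Finset.exists_le_of_sum_le Finset.univ_nonempty htot
  set b : Fin n → ℝ := fun j => ‖x j - x c‖ ^ 2 with hb
  set y : Fin n → EuclideanSpace ℝ (Fin k) :=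
    fun j => if 8 * Δ < ‖x j - x c‖ then x c else x j with hy
  set w : Fin n → ℝ := fun j => if 8 * Δ < ‖x j - x c‖ then 1 else 0 with hw
  set old : Fin n → Fin n → ℝ := fun i j => (d i j - ‖x i - x j‖) ^ 2 with hold
  have holdsym : ∀ i j, old i j = old j i := fun i j => by
    simp only [hold]; rw [hsym, norm_sub_rev]
  have hold0 : ∀ i j, 0 ≤ old i j := fun i j => sq_nonneg _
  have hb0 : ∀ i, 0 ≤ b i := fun i => sq_nonneg _
  refine ⟨y, ?_, ?_⟩
  · have key : ∀ i j, (d i j - ‖y i - y j‖) ^ 2 ≤ old i j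
        + (w i * (Δ ^ 2 + b j - old i j / 2) + w j * (Δ ^ 2 + b i - old j i / 2)) := by
      intro i j
      rw [holdsym j i]
      have e0 := hold0 i j
      have e1 := hb0 i
      have e2 := hb0 j
      have e3 := hdsq i j
      have e4 := h0 i j
      by_cases hi : 8 * Δ < ‖x i - x c‖ <;> by_cases hj : 8 * Δ < ‖x j - x c‖
      · simp only [hy, hw, hi, hj, if_true, sub_self, norm_zero, sub_zero]
        linarith [sq_nonneg Δ]
      · simp only [hy, hw, hi, hj, if_true, if_false]
        rw [norm_sub_rev]
        have : 0 ≤ d i j * ‖x j - x c‖ := by positivity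
        have : (d i j - ‖x j - x c‖) ^ 2 ≤ Δ ^ 2 + b j := by
          simp only [hb]; nlinarith
        linarith
      · simp only [hy, hw, hi, hj, if_true, if_false]
        have : 0 ≤ d i j * ‖x i - x c‖ := by positivity
        have : (d i j - ‖x i - x c‖) ^ 2 ≤ Δ ^ 2 + b i := by
          simp only [hb]; nlinarith
        linarith
      · simp only [hy, hw, hi, hj, if_false, hold]
        linarith
    have hrow : ∑ i, ∑ j, w i * (Δ ^ 2 + b j - old i j / 2) ≤ 0 := by
      refine Finset.sum_nonpos fun i _ => ?_
      rw [← Finset.mul_sum]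
      by_cases hi : 8 * Δ < ‖x i - x c‖
      · simp only [hw, hi, if_true, one_mul]
        have : ∑ j, (Δ ^ 2 + b j - old i j / 2)
            ≤ ∑ j, (3 / 2 * b j - 55 / 6 * Δ ^ 2) := by
          refine Finset.sum_le_sum fun j _ => ?_
          have t : ‖x i - x c‖ ≤ ‖x i - x j‖ + ‖x j - x c‖ := norm_sub_le_norm_sub_add_norm_sub ..
          have t2 : (8 * Δ) ^ 2 ≤ (‖x i - x j‖ + ‖x j - x c‖) ^ 2 := by
            gcongr; linarith
          have t3 := hdsq i j
          simp only [hb, hold]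
          nlinarith [sq_nonneg (‖x i - x j‖ - d i j - d i j),
            sq_nonneg (‖x i - x j‖ - d i j - ‖x j - x c‖), sq_nonneg (d i j - ‖x j - x c‖)]
        refine this.trans ?_
        simp only [Finset.sum_sub_distrib, ← Finset.mul_sum, Finset.sum_const, Finset.card_univ,
          Fintype.card_fin, nsmul_eq_mul]
        have : 0 ≤ (n : ℝ) * Δ ^ 2 := by positivity
        simp only [hb]
        nlinarith
      · simp [hw, hi]
    calc ∑ i, ∑ j, (d i j - ‖y i - y j‖) ^ 2
        ≤ ∑ i, ∑ j, (old i j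
          + (w i * (Δ ^ 2 + b j - old i j / 2) + w j * (Δ ^ 2 + b i - old j i / 2))) :=
          Finset.sum_le_sum fun i _ => Finset.sum_le_sum fun j _ => key i j
      _ = ∑ i, ∑ j, old i j + (∑ i, ∑ j, w i * (Δ ^ 2 + b j - old i j / 2)
          + ∑ i, ∑ j, w j * (Δ ^ 2 + b i - old j i / 2)) := by
          simp only [Finset.sum_add_distrib]
      _ = ∑ i, ∑ j, old i j + (∑ i, ∑ j, w i * (Δ ^ 2 + b j - old i j / 2)
          + ∑ i, ∑ j, w i * (Δ ^ 2 + b j - old i j / 2)) := by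
          congr 2; exact Finset.sum_comm
      _ ≤ ∑ i, ∑ j, old i j := by linarith
  · have hyc : ∀ i, ‖y i - x c‖ ≤ 8 * Δ := by
      intro i
      by_cases hi : 8 * Δ < ‖x i - x c‖
      · simp only [hy, hi, if_true, sub_self, norm_zero]; linarith
      · simp only [hy, hi, if_false]; linarith
    intro i j
    have t : ‖y i - y j‖ ≤ ‖y i - x c‖ + ‖x c - y j‖ := norm_sub_le_norm_sub_add_norm_sub ..
    rw [norm_sub_rev (x c)] at t
    linarith [hyc i, hyc j]

/-- existence of a near-optimal embedding of bounded diameter. -/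
theorem stmt_1 :
    ∃ C : ℝ, 1 ≤ C ∧
      ∀ (n k : ℕ), 1 ≤ n → 1 ≤ k →
      ∀ (Δ ε : ℝ), 1 ≤ Δ → 0 < ε → ε < 1 →
      ∀ d : Fin n → Fin n → ℝ,
        (∀ i j, d i j = d j i) → (∀ i j, 0 ≤ d i j) → (∀ i, d i i = 0) →
        (∀ i j, i ≠ j → 1 ≤ d i j ∧ d i j ≤ Δ) →
        ∃ x : Fin n → EuclideanSpace ℝ (Fin k),
          EMV n k d x ≤ OPTEMV n k d + ε * D2 n d ∧
          ∀ i j, ‖x i - x j‖ ≤ C * (Δ / ε) ^ C := by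
  refine ⟨16, by norm_num, ?_⟩
  intro n k hn hk Δ ε hΔ hε hε1 d hsym h0 hdiag hd
  have hnpos : (0 : ℝ) < n := by exact_mod_cast hn
  have hdle : ∀ i j, d i j ≤ Δ := fun i j => by
    by_cases h : i = j
    · subst h; rw [hdiag]; linarith
    · exact (hd i j h).2
  have hEMV0 : ∀ x, 0 ≤ EMV n k d x := fun x => by unfold EMV; positivity
  have hzero : EMV n k d (fun _ => 0) = D2 n d := by simp [EMV, D2]
  have hbdd : BddBelow {y | ∃ x : Fin n → EuclideanSpace ℝ (Fin k), y = EMV n k d x} :=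
    ⟨0, by rintro _ ⟨x, rfl⟩; exact hEMV0 x⟩
  have hne : {y | ∃ x : Fin n → EuclideanSpace ℝ (Fin k), y = EMV n k d x}.Nonempty :=
    ⟨_, fun _ => 0, rfl⟩
  have hOPT0 : 0 ≤ OPTEMV n k d := le_csInf hne (by rintro _ ⟨x, rfl⟩; exact hEMV0 x)
  have hOPT : OPTEMV n k d ≤ D2 n d := csInf_le hbdd ⟨fun _ => 0, hzero.symm⟩
  have hD0 : 0 ≤ D2 n d := hOPT0.trans hOPT
  have hDΔ : D2 n d ≤ Δ ^ 2 := by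
    have : ∑ i, ∑ j, d i j ^ 2 ≤ ∑ _i : Fin n, ∑ _j : Fin n, Δ ^ 2 := by
      refine Finset.sum_le_sum fun i _ => Finset.sum_le_sum fun j _ => ?_
      have := h0 i j; have := hdle i j; gcongr
    simp only [Finset.sum_const, Finset.card_univ, Fintype.card_fin, nsmul_eq_mul] at this
    unfold D2
    rw [one_div_mul_eq_div, div_le_iff₀ (by positivity)]
    linarith
  have hbound : 16 * Δ ≤ 16 * (Δ / ε) ^ (16 : ℝ) := by
    have h1 : Δ ≤ Δ / ε := by rw [le_div_iff₀ hε]; nlinarith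
    have h2 := Real.self_le_rpow_of_one_le (hΔ.trans h1) (by norm_num : (1 : ℝ) ≤ 16)
    linarith
  rcases hD0.eq_or_lt with hD | hD
  · refine ⟨fun _ => 0, ?_, fun i j => ?_⟩
    · rw [hzero, ← hD]; linarith
    · simp only [sub_self, norm_zero]; linarith
  · obtain ⟨_, ⟨x, rfl⟩, hx⟩ := exists_lt_of_csInf_lt hne
      (show sInf _ < OPTEMV n k d + ε * D2 n d from lt_add_of_pos_right _ (by positivity))
    have hx2 : EMV n k d x ≤ 2 * Δ ^ 2 := by nlinarith
    have hx3 : ∑ i, ∑ j, (d i j - ‖x i - x j‖) ^ 2 ≤ 2 * (n : ℝ) ^ 2 * Δ ^ 2 := by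
      unfold EMV at hx2
      rw [one_div_mul_eq_div, div_le_iff₀ (by positivity)] at hx2
      linarith
    obtain ⟨y, hy1, hy2⟩ := reduce_diam n k hn Δ hΔ d hsym h0 hdle x hx3
    refine ⟨y, ?_, fun i j => (hy2 i j).trans hbound⟩
    refine le_trans ?_ hx.le
    unfold EMV
    gcongr
end

section
/- There is an absolute constant C ≥ 1 such that the following holds. Let n, k ≥ 1, Δ ≥ 1, 0 < ε < 1, and let d be a distance input on n points with 1 ≤ d i j ≤ Δ for all i ≠ j. Then there exists a finite set Σ ⊆ ℝ, depending only on Δ, k and ε, with |Σ| ≤ C·(1/ε)·log(Δ·k/ε) + C, and an embedding x : Fin n → EuclideanSpace ℝ (Fin k) all of whose coordinates lie in Σ (i.e., (x i) ℓ ∈ Σ for every i ∈ Fin n and ℓ ∈ Fin k), such that EMV(d,x) ≤ OPT_EMV(d) + 16·ε·D₂(d). -/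
/-- A geometric grid. -/
lemma grid (a R η : ℝ) (ha : 0 < a) (haR : a ≤ R) (hη : 0 < η) (hη1 : η ≤ 1) :
    ∃ S : Finset ℝ, (S.card : ℝ) ≤ 3 + 4 * Real.log (R / a) / η ∧ (0 : ℝ) ∈ S ∧
      ∀ t : ℝ, |t| ≤ R → ∃ s ∈ S, (s - t) ^ 2 ≤ η ^ 2 * t ^ 2 + a ^ 2 := by
  classical
  have hlog : η / 2 ≤ Real.log (1 + η) := by
    have h := Real.one_sub_inv_le_log_of_pos (show 0 < 1 + η by linarith)
    have h2 : η / 2 ≤ 1 - (1 + η)⁻¹ := by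
      have : 1 - (1 + η)⁻¹ = η / (1 + η) := by field_simp; ring
      rw [this]
      exact div_le_div_of_nonneg_left hη.le (by linarith) (by linarith)
    linarith
  have hlogpos : 0 < Real.log (1 + η) := by linarith
  have hRa : 1 ≤ R / a := (one_le_div ha).2 haR
  have hL : 0 ≤ Real.log (R / a) := Real.log_nonneg hRa
  set N : ℕ := ⌊Real.log (R / a) / Real.log (1 + η)⌋₊ with hN
  have hNle : (N : ℝ) ≤ 2 * Real.log (R / a) / η := by
    have h1 : (N : ℝ) ≤ Real.log (R / a) / Real.log (1 + η) :=
      Nat.floor_le (div_nonneg hL hlogpos.le)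
    have h2 : Real.log (R / a) / Real.log (1 + η) ≤ Real.log (R / a) / (η / 2) :=
      div_le_div_of_nonneg_left hL (by linarith) hlog
    have h3 : Real.log (R / a) / (η / 2) = 2 * Real.log (R / a) / η := by field_simp
    linarith
  let P : Finset ℝ := (Finset.range (N + 1)).image (fun m => a * (1 + η) ^ m)
  let Q : Finset ℝ := (Finset.range (N + 1)).image (fun m => -(a * (1 + η) ^ m))
  have key : ∀ u : ℝ, a ≤ u → u ≤ R → ∃ m ∈ Finset.range (N + 1),
      (a * (1 + η) ^ m - u) ^ 2 ≤ η ^ 2 * u ^ 2 := by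
    intro u hu huR
    obtain ⟨m, hm1, hm2⟩ := exists_nat_pow_near ((one_le_div ha).2 hu)
      (show 1 < 1 + η by linarith)
    refine ⟨m, ?_, ?_⟩
    · rw [Finset.mem_range, Nat.lt_succ_iff]
      apply Nat.le_floor
      rw [le_div_iff₀ hlogpos, ← Real.log_pow]
      apply Real.log_le_log (by positivity)
      exact hm1.trans (div_le_div_of_nonneg_right huR ha.le)
    · rw [le_div_iff₀ ha] at hm1
      rw [div_lt_iff₀ ha, pow_succ] at hm2
      have hp : 0 < (1 + η) ^ m := by positivity
      have : |a * (1 + η) ^ m - u| ≤ |η * u| := by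
        rw [abs_of_nonpos (by nlinarith), abs_of_nonneg (by nlinarith)]
        nlinarith
      rw [← mul_pow]
      exact sq_le_sq.2 this
  refine ⟨insert 0 (P ∪ Q), ?_, Finset.mem_insert_self _ _, ?_⟩
  · have h1 : (insert 0 (P ∪ Q)).card ≤ (N + 1) + (N + 1) + 1 := by
      have hP : P.card ≤ N + 1 := by
        simpa using (Finset.card_image_le (s := Finset.range (N + 1)) (f := fun m => a * (1 + η) ^ m))
      have hQ : Q.card ≤ N + 1 := by
        simpa using (Finset.card_image_le (s := Finset.range (N + 1))
          (f := fun m => -(a * (1 + η) ^ m)))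
      have h3 := Finset.card_insert_le (0 : ℝ) (P ∪ Q)
      have h4 := Finset.card_union_le P Q
      omega
    have h2 : ((insert 0 (P ∪ Q)).card : ℝ) ≤ (N + 1) + (N + 1) + 1 := by exact_mod_cast h1
    have h3 : 4 * Real.log (R / a) / η = 2 * (2 * Real.log (R / a) / η) := by ring
    linarith
  · intro t ht
    by_cases hta : |t| ≤ a
    · refine ⟨0, Finset.mem_insert_self _ _, ?_⟩
      have := sq_le_sq' (by linarith [abs_nonneg t]) hta
      rw [sq_abs] at this
      nlinarith [mul_nonneg (sq_nonneg η) (sq_nonneg t)]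
    · push Not at hta
      obtain ⟨m, hm, h⟩ := key |t| hta.le ht
      rw [sq_abs] at h
      rcases le_total 0 t with h0 | h0
      · rw [abs_of_nonneg h0] at h
        refine ⟨a * (1 + η) ^ m, ?_, by nlinarith⟩
        exact Finset.mem_insert_of_mem (Finset.mem_union_left _ (Finset.mem_image_of_mem _ hm))
      · rw [abs_of_nonpos h0] at h
        refine ⟨-(a * (1 + η) ^ m), ?_, by nlinarith⟩
        exact Finset.mem_insert_of_mem (Finset.mem_union_right _
          (Finset.mem_image_of_mem (fun m => -(a * (1 + η) ^ m)) hm))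

/-- The unnormalised cost. -/
noncomputable def cost {n k : ℕ} (d : Fin n → Fin n → ℝ)
    (x : Fin n → EuclideanSpace ℝ (Fin k)) : ℝ := ∑ i, ∑ j, (d i j - ‖x i - x j‖) ^ 2

/-- Pivoting. -/
lemma pivot {n k : ℕ} (hn : 1 ≤ n) (d : Fin n → Fin n → ℝ)
    (x : Fin n → EuclideanSpace ℝ (Fin k)) :
    ∃ z : Fin n → EuclideanSpace ℝ (Fin k), cost d z = cost d x ∧
      n * ∑ i, ‖z i‖ ^ 2 ≤ 2 * cost d x + 2 * ∑ i, ∑ j, d i j ^ 2 := by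
  have hne : (Finset.univ : Finset (Fin n)).Nonempty := ⟨⟨0, hn⟩, Finset.mem_univ _⟩
  set T := ∑ i, ∑ j, ‖x j - x i‖ ^ 2 with hT
  have hTle : T ≤ 2 * cost d x + 2 * ∑ i, ∑ j, d i j ^ 2 := by
    rw [hT, cost]
    simp only [Finset.mul_sum, ← Finset.sum_add_distrib]
    refine Finset.sum_le_sum fun i _ => Finset.sum_le_sum fun j _ => ?_
    rw [norm_sub_rev]
    nlinarith [sq_nonneg (2 * d i j - ‖x i - x j‖)]
  obtain ⟨i0, -, hi0⟩ := Finset.exists_le_of_sum_le hne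
    (f := fun i => ∑ j, ‖x j - x i‖ ^ 2) (g := fun _ => T / n) (by
      have : (n : ℝ) ≠ 0 := by positivity
      simp only [Finset.sum_const, Finset.card_univ, Fintype.card_fin, nsmul_eq_mul]
      rw [mul_div_cancel₀ _ this])
  refine ⟨fun i => x i - x i0, ?_, ?_⟩
  · simp [cost]
  · refine le_trans ?_ hTle
    have : (0 : ℝ) < n := by positivity
    rw [le_div_iff₀ this] at hi0
    linarith

/-- Truncation. -/
lemma trunc_s2 {n k : ℕ} (d : Fin n → Fin n → ℝ) (Δ R : ℝ) (hR : 0 < R)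
    (hd0 : ∀ i j, 0 ≤ d i j) (hd : ∀ i j, d i j ≤ Δ)
    (x : Fin n → EuclideanSpace ℝ (Fin k)) :
    ∃ z : Fin n → EuclideanSpace ℝ (Fin k), (∀ i, ‖z i‖ ≤ R) ∧ (∀ i, ‖z i‖ ≤ ‖x i‖) ∧
      cost d z ≤ cost d x + 2 * ((∑ i, ‖x i‖ ^ 2) / R ^ 2) * (n * Δ ^ 2 + ∑ i, ‖x i‖ ^ 2) := by
  classical
  let z : Fin n → EuclideanSpace ℝ (Fin k) := fun i => if ‖x i‖ ≤ R then x i else 0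
  have hzx : ∀ i, ‖z i‖ ≤ ‖x i‖ := by
    intro i; simp only [z]; split_ifs <;> simp
  refine ⟨z, ?_, hzx, ?_⟩
  · intro i; simp only [z]; split_ifs with h
    · exact h
    · simpa using hR.le
  · let b : Fin n → ℝ := fun i => ‖x i‖ ^ 2 / R ^ 2
    have hb0 : ∀ i, 0 ≤ b i := fun i => by simp only [b]; positivity
    have hb1 : ∀ i, ¬ ‖x i‖ ≤ R → 1 ≤ b i := by
      intro i hi
      push Not at hi
      simp only [b]
      rw [one_le_div (by positivity)]
      nlinarith
    have hpair : ∀ i j, (d i j - ‖z i - z j‖) ^ 2 ≤ (d i j - ‖x i - x j‖) ^ 2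
        + (b i * (Δ ^ 2 + ‖x j‖ ^ 2) + b j * (Δ ^ 2 + ‖x i‖ ^ 2)) := by
      intro i j
      have hd1 := hd0 i j
      have hd2 : d i j ^ 2 ≤ Δ ^ 2 := by nlinarith [hd i j]
      have p1 : 0 ≤ b i * (Δ ^ 2 + ‖x j‖ ^ 2) := mul_nonneg (hb0 i) (by positivity)
      have p2 : 0 ≤ b j * (Δ ^ 2 + ‖x i‖ ^ 2) := mul_nonneg (hb0 j) (by positivity)
      have p3 := sq_nonneg (d i j - ‖x i - x j‖)
      by_cases hi : ‖x i‖ ≤ R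
      · by_cases hj : ‖x j‖ ≤ R
        · simp only [z, if_pos hi, if_pos hj]; linarith
        · have e : ‖z i - z j‖ = ‖x i‖ := by simp [z, hi, hj]
          rw [e]
          have : 1 * (Δ ^ 2 + ‖x i‖ ^ 2) ≤ b j * (Δ ^ 2 + ‖x i‖ ^ 2) :=
            mul_le_mul_of_nonneg_right (hb1 j hj) (by positivity)
          nlinarith [mul_nonneg hd1 (norm_nonneg (x i))]
      · have e : ‖z i - z j‖ ≤ ‖x j‖ := by
          have : z i = 0 := by simp [z, hi]
          rw [this, zero_sub, norm_neg]; exact hzx j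
        have : 1 * (Δ ^ 2 + ‖x j‖ ^ 2) ≤ b i * (Δ ^ 2 + ‖x j‖ ^ 2) :=
            mul_le_mul_of_nonneg_right (hb1 i hi) (by positivity)
        nlinarith [mul_nonneg hd1 (norm_nonneg (z i - z j)), norm_nonneg (z i - z j)]
    have hsum : cost d z ≤ ∑ i, ∑ j, ((d i j - ‖x i - x j‖) ^ 2
        + (b i * (Δ ^ 2 + ‖x j‖ ^ 2) + b j * (Δ ^ 2 + ‖x i‖ ^ 2))) :=
      Finset.sum_le_sum fun i _ => Finset.sum_le_sum fun j _ => hpair i j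
    refine hsum.trans (le_of_eq ?_)
    have hA : ∑ i, (Δ ^ 2 + ‖x i‖ ^ 2) = n * Δ ^ 2 + ∑ i, ‖x i‖ ^ 2 := by
      simp [Finset.sum_add_distrib]
    have hB : ∑ i, b i = (∑ i, ‖x i‖ ^ 2) / R ^ 2 := by
      simp only [b, Finset.sum_div]
    rw [← hA, ← hB]
    simp only [Finset.sum_add_distrib (f := fun i => (_ : ℝ)), cost]
    have e1 : ∑ i, ∑ j, b i * (Δ ^ 2 + ‖x j‖ ^ 2) = (∑ i, b i) * ∑ i, (Δ ^ 2 + ‖x i‖ ^ 2) := by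
      rw [Finset.sum_mul_sum]
    have e2 : ∑ i, ∑ j, b j * (Δ ^ 2 + ‖x i‖ ^ 2) = (∑ i, b i) * ∑ i, (Δ ^ 2 + ‖x i‖ ^ 2) := by
      rw [Finset.sum_comm, Finset.sum_mul_sum]
    simp only [Finset.sum_add_distrib] at e1 e2 ⊢
    simp only [mul_add, Finset.sum_add_distrib] at e1 e2 ⊢
    linarith

/-- Perturbation. -/
lemma perturb {n k : ℕ} (d : Fin n → Fin n → ℝ) (η : ℝ) (hη : 0 < η)
    (z y : Fin n → EuclideanSpace ℝ (Fin k)) :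
    cost d y ≤ (1 + η) * cost d z + (1 + 1 / η) * (4 * n * ∑ i, ‖y i - z i‖ ^ 2) := by
  have hpair : ∀ i j, (d i j - ‖y i - y j‖) ^ 2 ≤ (1 + η) * (d i j - ‖z i - z j‖) ^ 2
      + (1 + 1 / η) * (2 * ‖y i - z i‖ ^ 2 + 2 * ‖y j - z j‖ ^ 2) := by
    intro i j
    set p := ‖y i - y j‖ - ‖z i - z j‖ with hp
    set a := d i j - ‖z i - z j‖ with ha
    have e : d i j - ‖y i - y j‖ = a - p := by rw [hp, ha]; ring
    have h1 : |p| ≤ ‖y i - z i‖ + ‖y j - z j‖ := by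
      refine (abs_norm_sub_norm_le _ _).trans ?_
      have : y i - y j - (z i - z j) = (y i - z i) - (y j - z j) := by abel
      rw [this]; exact norm_sub_le _ _
    have h2 : p ^ 2 ≤ 2 * ‖y i - z i‖ ^ 2 + 2 * ‖y j - z j‖ ^ 2 := by
      rw [← sq_abs]
      nlinarith [abs_nonneg p, sq_nonneg (‖y i - z i‖ - ‖y j - z j‖)]
    have h3 : (a - p) ^ 2 ≤ (1 + η) * a ^ 2 + (1 + 1 / η) * p ^ 2 := by
      have : (1 + η) * a ^ 2 + (1 + 1 / η) * p ^ 2 - (a - p) ^ 2 = (η * a + p) ^ 2 / η := by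
        field_simp; ring
      have : 0 ≤ (η * a + p) ^ 2 / η := by positivity
      linarith
    rw [e]
    have : (1 + 1 / η) * p ^ 2 ≤ (1 + 1 / η) * (2 * ‖y i - z i‖ ^ 2 + 2 * ‖y j - z j‖ ^ 2) :=
      mul_le_mul_of_nonneg_left h2 (by positivity)
    linarith
  refine (Finset.sum_le_sum fun i _ => Finset.sum_le_sum fun j _ => hpair i j).trans (le_of_eq ?_)
  simp only [Finset.sum_add_distrib, ← Finset.mul_sum, cost, Finset.sum_const, Finset.card_univ,
    Fintype.card_fin, nsmul_eq_mul]
  ring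

lemma rounding {n k : ℕ} (S : Finset ℝ) (R η a : ℝ)
    (hS : ∀ t : ℝ, |t| ≤ R → ∃ s ∈ S, (s - t) ^ 2 ≤ η ^ 2 * t ^ 2 + a ^ 2)
    (z : Fin n → EuclideanSpace ℝ (Fin k)) (hz : ∀ i, ‖z i‖ ≤ R) :
    ∃ y : Fin n → EuclideanSpace ℝ (Fin k), (∀ i l, y i l ∈ S) ∧
      ∀ i, ‖y i - z i‖ ^ 2 ≤ η ^ 2 * ‖z i‖ ^ 2 + k * a ^ 2 := by
  have h : ∀ i l, ∃ s ∈ S, (s - z i l) ^ 2 ≤ η ^ 2 * (z i l) ^ 2 + a ^ 2 := by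
    intro i l
    apply hS
    have := PiLp.norm_apply_le (z i) l
    rw [Real.norm_eq_abs] at this
    exact this.trans (hz i)
  choose s hs1 hs2 using h
  refine ⟨fun i => WithLp.toLp 2 (s i), fun i l => hs1 i l, fun i => ?_⟩
  rw [EuclideanSpace.real_norm_sq_eq, EuclideanSpace.real_norm_sq_eq]
  refine (Finset.sum_le_sum (fun l _ => ?_)).trans (le_of_eq ?_) (b := ∑ l, (η ^ 2 * (z i l) ^ 2 + a ^ 2))
  · simpa using hs2 i l
  · simp [Finset.sum_add_distrib, Finset.mul_sum]

set_option maxHeartbeats 4000000 in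
/-- discretization with a small alphabet (depending only on Δ, k, ε)
incurs small additive error. -/
theorem stmt_2 :
    ∃ C : ℝ, 1 ≤ C ∧
      ∀ (k : ℕ), 1 ≤ k →
      ∀ (Δ ε : ℝ), 1 ≤ Δ → 0 < ε → ε < 1 →
      ∃ S : Finset ℝ,
        (S.card : ℝ) ≤ C * (1 / ε) * Real.log (Δ * k / ε) + C ∧
        ∀ (n : ℕ), 1 ≤ n →
        ∀ d : Fin n → Fin n → ℝ,
          (∀ i j, d i j = d j i) → (∀ i j, 0 ≤ d i j) → (∀ i, d i i = 0) →
          (∀ i j, i ≠ j → 1 ≤ d i j ∧ d i j ≤ Δ) →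
          ∃ x : Fin n → EuclideanSpace ℝ (Fin k),
            (∀ i ℓ, x i ℓ ∈ S) ∧
            EMV n k d x ≤ OPTEMV n k d + 16 * ε * D2 n d := by
  refine ⟨10000, by norm_num, ?_⟩
  intro k hk Δ ε hΔ hε hε1
  have hk1 : (1 : ℝ) ≤ k := by exact_mod_cast hk
  have hk0 : (0 : ℝ) < k := by linarith
  set a : ℝ := ε / 8 / k with ha
  set R : ℝ := 10 * Δ / ε with hR
  have hapos : 0 < a := by positivity
  have hRpos : 0 < R := by positivity
  have ha1 : a ≤ 1 := by
    rw [ha, div_div, div_le_one (by positivity)]; linarith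
  have hR1 : 10 * Δ ≤ R := by
    rw [hR, le_div_iff₀ hε]; nlinarith
  obtain ⟨S, hcard, h0S, hS⟩ := grid a R (ε / 8) hapos (by linarith) (by positivity) (by linarith)
  refine ⟨S, ?_, ?_⟩
  · have hRa : R / a = 80 * (1 / ε) * (Δ * k / ε) := by
      rw [hR, ha]; field_simp; ring
    have hle : Real.log (1 / ε) ≤ Real.log (Δ * k / ε) := by
      apply Real.log_le_log (by positivity)
      apply div_le_div_of_nonneg_right _ hε.le
      nlinarith
    have h1 : 1 - ε ≤ Real.log (1 / ε) := by
      have := Real.one_sub_inv_le_log_of_pos (show 0 < 1 / ε by positivity)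
      simpa using this
    have hl80 : Real.log 80 ≤ 79 := by
      have := Real.log_le_sub_one_of_pos (show (0 : ℝ) < 80 by norm_num)
      linarith
    rw [hRa, Real.log_mul (by positivity) (by positivity),
      Real.log_mul (by positivity) (by positivity)] at hcard
    set L := Real.log (Δ * k / ε)
    set u := 1 / ε with hu
    have hu0 : 0 < u := by positivity
    have hue : u * ε = 1 := by rw [hu]; field_simp
    have h2 : u - 1 ≤ u * L := by nlinarith
    have h3 : 4 * (Real.log 80 + Real.log u + L) / (ε / 8)
        = 32 * (u * (Real.log 80 + Real.log u + L)) := by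
      rw [hu]; field_simp; ring
    have h4 : u * (Real.log 80 + Real.log u + L) ≤ u * (79 + L + L) :=
      mul_le_mul_of_nonneg_left (by linarith) hu0.le
    have h5 : 0 ≤ u * L := mul_nonneg hu0.le (by linarith)
    rw [h3] at hcard
    nlinarith
  · intro n hn d hsymm hd0 hdd hd
    have hOPT0 : 0 ≤ OPTEMV n k d := by
      apply Real.sInf_nonneg
      rintro _ ⟨x, rfl⟩
      unfold EMV; positivity
    rcases Nat.lt_or_ge n 2 with hn2 | hn2
    · obtain rfl : n = 1 := by omega
      refine ⟨fun _ => 0, fun i l => by simpa using h0S, ?_⟩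
      have : EMV 1 k d (fun _ => 0) = 0 := by
        simp [EMV, hdd]
      rw [this]
      have : 0 ≤ D2 1 d := by unfold D2; positivity
      positivity
    have hn0 : (0 : ℝ) < n := by positivity
    have hn2' : (2 : ℝ) ≤ n := by exact_mod_cast hn2
    have hEMV : ∀ x : Fin n → EuclideanSpace ℝ (Fin k), cost d x = (n : ℝ) ^ 2 * EMV n k d x := by
      intro x; simp only [EMV, cost]; field_simp
    have hD2 : ∑ i, ∑ j, d i j ^ 2 = (n : ℝ) ^ 2 * D2 n d := by
      simp only [D2]; field_simp
    set D := D2 n d with hD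
    have hdΔ : ∀ i j, d i j ≤ Δ := by
      intro i j
      by_cases h : i = j
      · rw [h, hdd]; linarith
      · exact (hd i j h).2
    have hDle : D ≤ Δ ^ 2 := by
      have : ∑ i, ∑ j, d i j ^ 2 ≤ ∑ i : Fin n, ∑ j : Fin n, Δ ^ 2 :=
        Finset.sum_le_sum fun i _ => Finset.sum_le_sum fun j _ => by
          nlinarith [hd0 i j, hdΔ i j]
      rw [hD2] at this
      simp only [Finset.sum_const, Finset.card_univ, Fintype.card_fin, nsmul_eq_mul] at this
      have h2 : (n : ℝ) ^ 2 * D ≤ (n : ℝ) ^ 2 * Δ ^ 2 := by linarith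
      exact le_of_mul_le_mul_left h2 (by positivity)
    have hDge : 1 / 2 ≤ D := by
      have : ∑ i : Fin n, ∑ j : Fin n, ((1 : ℝ) - if i = j then 1 else 0)
          ≤ ∑ i, ∑ j, d i j ^ 2 :=
        Finset.sum_le_sum fun i _ => Finset.sum_le_sum fun j _ => by
          split_ifs with h
          · simp [sq_nonneg]
          · nlinarith [(hd i j h).1]
      rw [hD2] at this
      simp [Finset.sum_sub_distrib] at this
      by_contra hc
      push Not at hc
      have : (n : ℝ) ^ 2 * D < (n : ℝ) ^ 2 * (1 / 2) :=
        mul_lt_mul_of_pos_left hc (by positivity)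
      nlinarith
    have hDpos : 0 < D := by linarith
    have hbdd : BddBelow {y | ∃ x : Fin n → EuclideanSpace ℝ (Fin k), y = EMV n k d x} := by
      refine ⟨0, ?_⟩
      rintro _ ⟨x, rfl⟩
      unfold EMV; positivity
    have hOPTD : OPTEMV n k d ≤ D := by
      refine csInf_le hbdd ⟨fun _ => 0, ?_⟩
      simp [hD, D2, EMV]
    obtain ⟨_, ⟨x, rfl⟩, hx⟩ := exists_lt_of_csInf_lt
      (s := {y | ∃ x : Fin n → EuclideanSpace ℝ (Fin k), y = EMV n k d x})
      ⟨_, fun _ => 0, rfl⟩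
      (show sInf {y | ∃ x : Fin n → EuclideanSpace ℝ (Fin k), y = EMV n k d x}
        < OPTEMV n k d + ε * D from lt_add_of_pos_right _ (by positivity))
    obtain ⟨w, hw1, hw2⟩ := pivot hn d x
    have hεD : ε * D ≤ D := by nlinarith
    have hX : ∑ i, ‖w i‖ ^ 2 ≤ 6 * n * D := by
      rw [hEMV, hD2] at hw2
      have : (n : ℝ) ^ 2 * EMV n k d x ≤ (n : ℝ) ^ 2 * (2 * D) :=
        mul_le_mul_of_nonneg_left (by linarith) (by positivity)
      have h2 : (n : ℝ) * ∑ i, ‖w i‖ ^ 2 ≤ n * (6 * n * D) := by nlinarith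
      exact le_of_mul_le_mul_left h2 hn0
    obtain ⟨z, hzR, hzw, hz⟩ := trunc_s2 d Δ R hRpos hd0 hdΔ w
    have hX0 : 0 ≤ ∑ i, ‖w i‖ ^ 2 := Finset.sum_nonneg fun i _ => by positivity
    have hZ : ∑ i, ‖z i‖ ^ 2 ≤ 6 * n * D := by
      refine le_trans (Finset.sum_le_sum fun i _ => ?_) hX
      nlinarith [hzw i, norm_nonneg (z i)]
    have hEz : EMV n k d z ≤ OPTEMV n k d + 2 * ε * D := by
      set X := ∑ i, ‖w i‖ ^ 2
      have h1 : 2 * (X / R ^ 2) * (n * Δ ^ 2 + X) ≤ (n : ℝ) ^ 2 * (ε * D) := by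
        have e1 : n * Δ ^ 2 + X ≤ 7 * n * Δ ^ 2 := by nlinarith
        have e2 : X / R ^ 2 ≤ 6 * n * D / R ^ 2 := div_le_div_of_nonneg_right hX (by positivity)
        have e3 : 2 * (X / R ^ 2) * (n * Δ ^ 2 + X)
            ≤ 2 * (6 * n * D / R ^ 2) * (7 * n * Δ ^ 2) := by
          apply mul_le_mul _ e1 (by positivity) (by positivity)
          linarith
        have e4 : 2 * (6 * n * D / R ^ 2) * (7 * n * Δ ^ 2) = (n : ℝ) ^ 2 * (ε * D) * (84 / 100 * ε) := by
          rw [hR]; field_simp; ring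
        have e5 : 0 ≤ (n : ℝ) ^ 2 * (ε * D) := by positivity
        nlinarith
      rw [hw1, hEMV, hEMV] at hz
      have h2 : (n : ℝ) ^ 2 * EMV n k d z ≤ (n : ℝ) ^ 2 * (EMV n k d x + ε * D) := by linarith
      have h3 := le_of_mul_le_mul_left h2 (by positivity)
      linarith
    obtain ⟨y, hyS, hy⟩ := rounding S R (ε / 8) a hS z hzR
    refine ⟨y, hyS, ?_⟩
    have hka : k * a ^ 2 ≤ (ε / 8) ^ 2 := by
      have : k * a ^ 2 = (ε / 8) ^ 2 / k := by rw [ha]; field_simp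
      rw [this]; exact div_le_self (by positivity) hk1
    have hE : ∑ i, ‖y i - z i‖ ^ 2 ≤ (ε / 8) ^ 2 * (8 * n * D) := by
      have h1 : ∑ i, ‖y i - z i‖ ^ 2 ≤ ∑ i, ((ε / 8) ^ 2 * ‖z i‖ ^ 2 + (ε / 8) ^ 2) :=
        Finset.sum_le_sum fun i _ => (hy i).trans (by linarith)
      have h2 : ∑ i, ((ε / 8) ^ 2 * ‖z i‖ ^ 2 + (ε / 8) ^ 2)
          = (ε / 8) ^ 2 * (∑ i, ‖z i‖ ^ 2 + n) := by
        simp [Finset.sum_add_distrib, ← Finset.mul_sum]; ring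
      rw [h2] at h1
      refine h1.trans (mul_le_mul_of_nonneg_left ?_ (by positivity))
      nlinarith
    have hp := perturb d (ε / 8) (by positivity) z y
    rw [hEMV, hEMV] at hp
    have h1 : (1 + 1 / (ε / 8)) * (4 * n * ∑ i, ‖y i - z i‖ ^ 2) ≤ (n : ℝ) ^ 2 * (64 * (ε / 8) * D) := by
      have e1 : (1 + 1 / (ε / 8)) * (4 * n * ∑ i, ‖y i - z i‖ ^ 2)
          ≤ (1 + 1 / (ε / 8)) * (4 * n * ((ε / 8) ^ 2 * (8 * n * D))) := by gcongr
      have e2 : (1 + 1 / (ε / 8)) * (4 * n * ((ε / 8) ^ 2 * (8 * n * D)))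
          = (n : ℝ) ^ 2 * (32 * (ε / 8) * D) * (1 + ε / 8) := by field_simp; ring
      have e3 : 0 ≤ (n : ℝ) ^ 2 * (32 * (ε / 8) * D) := by positivity
      nlinarith
    have h2 : (n : ℝ) ^ 2 * EMV n k d y
        ≤ (n : ℝ) ^ 2 * ((1 + ε / 8) * EMV n k d z + 64 * (ε / 8) * D) := by linarith
    have h3 := le_of_mul_le_mul_left h2 (by positivity)
    have h4 : EMV n k d z ≤ 3 * D := by nlinarith
    have h5 : ε * EMV n k d z ≤ ε * (3 * D) := mul_le_mul_of_nonneg_left h4 hε.le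
    have h6 : 0 < ε * D := by positivity
    nlinarith
end

section
/- There are absolute constants C, C' ≥ 1 such that the following holds. Let n, k ≥ 1, Δ ≥ 1, 0 < ε < 1, and let d be a distance input on n points with 1 ≤ d i j ≤ Δ for all i ≠ j. Then there exist a finite set Σ ⊆ ℝ with 0 ∈ Σ and |Σ| ≤ C·(1/ε)·log(Δ·k/ε) + C, an index a ∈ Fin n, and an embedding x̂ : Fin n → EuclideanSpace ℝ (Fin k) all of whose coordinates lie in Σ, such that: (1) x̂ a = 0; (2) (1/n)·∑_{i ∈ Fin n} ‖x̂ i‖² ≤ 6·D₂(d); and (3) EMV(d, x̂) ≤ OPT_EMV(d) + C'·ε·D₂(d). -/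
lemma grid_aux (τ ε R : ℝ) (hτ : 0 < τ) (hε : 0 < ε) (hε1 : ε < 1) (hR : τ ≤ R) :
    ∃ S : Finset ℝ, (0 : ℝ) ∈ S ∧ (S.card : ℝ) ≤ (4 / ε) * Real.log (R / τ) + 3 ∧
      ∀ w : ℝ, |w| ≤ R → ∃ x ∈ S, |x| ≤ |w| ∧ |x - w| ≤ ε * |w| + τ := by
  have hq : 1 ≤ R / τ := (one_le_div hτ).2 hR
  have hL : 0 ≤ Real.log (R / τ) := Real.log_nonneg hq
  have hlog : ε / 2 ≤ Real.log (1 + ε) := by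
    have h := Real.one_sub_inv_le_log_of_pos (x := 1 + ε) (by linarith)
    refine le_trans ?_ h
    have : 1 - (1 + ε)⁻¹ = ε / (1 + ε) := by field_simp; ring
    rw [this]
    exact div_le_div_of_nonneg_left hε.le (by linarith) (by linarith)
  obtain ⟨T, hT1, hT2⟩ : ∃ T : ℕ, (2 / ε) * Real.log (R / τ) < T ∧
      (T : ℝ) ≤ (2 / ε) * Real.log (R / τ) + 1 := by
    refine ⟨⌊(2 / ε) * Real.log (R / τ)⌋₊ + 1, ?_, ?_⟩
    · push_cast; exact Nat.lt_floor_add_one _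
    · push_cast
      have := Nat.floor_le (a := (2 / ε) * Real.log (R / τ)) (by positivity)
      linarith
  have hpow : R / τ < (1 + ε) ^ T := by
    have h0 : 0 < R / τ := by linarith
    rw [← Real.log_lt_log_iff h0 (by positivity), Real.log_pow]
    have h1 : Real.log (R / τ) < T * (ε / 2) := by
      have := mul_lt_mul_of_pos_right hT1 (show 0 < ε / 2 by linarith)
      have e : 2 / ε * Real.log (R / τ) * (ε / 2) = Real.log (R / τ) := by field_simp
      linarith
    have h2 : (T : ℝ) * (ε / 2) ≤ T * Real.log (1 + ε) := by gcongr
    linarith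
  classical
  let f : ℕ → ℝ := fun t => τ * (1 + ε) ^ t
  refine ⟨insert 0 ((Finset.range T).image f ∪ (Finset.range T).image (fun t => - f t)),
    Finset.mem_insert_self _ _, ?_, ?_⟩
  · have h1 : (insert 0 ((Finset.range T).image f ∪
        (Finset.range T).image (fun t => - f t))).card ≤ T + T + 1 := by
      refine (Finset.card_insert_le _ _).trans ?_
      gcongr
      refine (Finset.card_union_le _ _).trans ?_
      gcongr
      · exact Finset.card_image_le.trans (by simp)
      · exact Finset.card_image_le.trans (by simp)
    have h2 : ((insert 0 ((Finset.range T).image f ∪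
        (Finset.range T).image (fun t => - f t))).card : ℝ) ≤ T + T + 1 := by exact_mod_cast h1
    have e : 4 / ε * Real.log (R / τ) = 2 * (2 / ε * Real.log (R / τ)) := by ring
    linarith
  · intro w hw
    by_cases hwt : |w| < τ
    · refine ⟨0, Finset.mem_insert_self _ _, by simp, ?_⟩
      rw [zero_sub, abs_neg]
      have : 0 ≤ ε * |w| := by positivity
      linarith
    push Not at hwt
    obtain ⟨t, ht1, ht2⟩ := exists_nat_pow_near ((one_le_div hτ).2 hwt)
      (show 1 < 1 + ε by linarith)
    have htT : t < T := by
      have : (1 + ε) ^ t < (1 + ε) ^ T :=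
        lt_of_le_of_lt (ht1.trans (div_le_div_of_nonneg_right hw hτ.le)) hpow
      exact (pow_lt_pow_iff_right₀ (by linarith)).1 this
    have hf0 : 0 < f t := by positivity
    have hf1 : f t ≤ |w| := by
      have := (le_div_iff₀ hτ).1 ht1
      simp only [f]; linarith
    have hf2 : |w| < f t * (1 + ε) := by
      have := (div_lt_iff₀ hτ).1 ht2
      simp only [f]; rw [pow_succ] at this; linarith
    have hf3 : ε * f t ≤ ε * |w| := by gcongr
    rcases le_total 0 w with h | h
    · refine ⟨f t, ?_, ?_, ?_⟩
      · simp only [Finset.mem_insert, Finset.mem_union, Finset.mem_image, Finset.mem_range]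
        exact Or.inr (Or.inl ⟨t, htT, rfl⟩)
      · rw [abs_of_pos hf0]; exact hf1
      · rw [abs_of_nonneg h] at *
        rw [abs_le]; constructor <;> nlinarith
    · refine ⟨- f t, ?_, ?_, ?_⟩
      · simp only [Finset.mem_insert, Finset.mem_union, Finset.mem_image, Finset.mem_range]
        exact Or.inr (Or.inr ⟨t, htT, rfl⟩)
      · rw [abs_neg, abs_of_pos hf0]; exact hf1
      · rw [abs_of_nonpos h] at *
        rw [abs_le]; constructor <;> nlinarith

lemma card_aux (k : ℕ) (hk : 1 ≤ k) (Δ ε : ℝ) (hΔ : 1 ≤ Δ) (hε : 0 < ε) (hε1 : ε < 1) :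
    0 ≤ Real.log (Δ * k / ε) ∧
    (4 / ε) * Real.log ((10 * Δ / ε) / (ε / k)) + 3
      ≤ 100 * (1 / ε) * Real.log (Δ * k / ε) + 100 := by
  have hk' : (1 : ℝ) ≤ k := by exact_mod_cast hk
  have hΔk : 1 ≤ Δ * k := by nlinarith
  have hu : 1 / ε ≤ Δ * k / ε := by gcongr
  have hu1 : 1 ≤ 1 / ε := (one_le_div hε).2 hε1.le
  have hL : 0 ≤ Real.log (Δ * k / ε) := Real.log_nonneg (by linarith)
  refine ⟨hL, ?_⟩
  have hle : (10 * Δ / ε) / (ε / k) ≤ 10 * (Δ * k / ε) ^ 2 := by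
    have : (10 * Δ / ε) / (ε / k) = 10 * (Δ * k) / ε ^ 2 := by field_simp
    rw [this, div_pow, ← mul_div_assoc]
    gcongr
    nlinarith
  have hlog : Real.log ((10 * Δ / ε) / (ε / k)) ≤ 10 + 2 * Real.log (Δ * k / ε) := by
    have h1 := Real.log_le_log (by positivity) hle
    rw [Real.log_mul (by norm_num) (by positivity), Real.log_pow] at h1
    have h2 := Real.log_le_sub_one_of_pos (show (0:ℝ) < 10 by norm_num)
    push_cast at h1
    linarith
  have hinv : 1 / ε ≤ 1 / ε * Real.log (Δ * k / ε) + 1 := by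
    have h1 := Real.one_sub_inv_le_log_of_pos (show 0 < Δ * k / ε by positivity)
    have h2 : (Δ * k / ε)⁻¹ ≤ ε := by
      rw [inv_div]
      exact div_le_self hε.le hΔk
    have h3 : 1 / ε * (1 - ε) ≤ 1 / ε * Real.log (Δ * k / ε) := by gcongr; linarith
    have h4 : 1 / ε * (1 - ε) = 1 / ε - 1 := by field_simp
    linarith
  have h5 : (4 / ε) * Real.log ((10 * Δ / ε) / (ε / k)) ≤
      (4 / ε) * (10 + 2 * Real.log (Δ * k / ε)) := by gcongr
  have e : (4 / ε) * (10 + 2 * Real.log (Δ * k / ε)) =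
    40 * (1 / ε) + 8 * (1 / ε * Real.log (Δ * k / ε)) := by ring
  have h6 : 0 ≤ 1 / ε * Real.log (Δ * k / ε) := by positivity
  nlinarith

lemma round_vec (k : ℕ) (hk : 1 ≤ k) (ε R : ℝ) (hε : 0 < ε) (S : Finset ℝ)
    (hS : ∀ w : ℝ, |w| ≤ R → ∃ x ∈ S, |x| ≤ |w| ∧ |x - w| ≤ ε * |w| + ε / k)
    (w : EuclideanSpace ℝ (Fin k)) (hw : ‖w‖ ≤ R) :
    ∃ x : EuclideanSpace ℝ (Fin k), (∀ l, x l ∈ S) ∧ ‖x‖ ^ 2 ≤ ‖w‖ ^ 2 ∧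
      ‖x - w‖ ^ 2 ≤ 2 * ε ^ 2 * ‖w‖ ^ 2 + 2 * ε ^ 2 := by
  have hk' : (1 : ℝ) ≤ k := by exact_mod_cast hk
  have h : ∀ l, ∃ x ∈ S, |x| ≤ |w l| ∧ |x - w l| ≤ ε * |w l| + ε / k := by
    intro l
    refine hS _ (le_trans ?_ hw)
    have := PiLp.norm_apply_le w l
    simpa using this
  choose g hg1 hg2 hg3 using h
  refine ⟨WithLp.toLp 2 g, fun l => hg1 l, ?_, ?_⟩
  · rw [EuclideanSpace.real_norm_sq_eq, EuclideanSpace.real_norm_sq_eq]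
    exact Finset.sum_le_sum fun l _ => sq_le_sq.2 (hg2 l)
  · rw [EuclideanSpace.real_norm_sq_eq, EuclideanSpace.real_norm_sq_eq]
    have h1 : ∀ l, (g l - w l) ^ 2 ≤ 2 * ε ^ 2 * (w l) ^ 2 + 2 * (ε / k) ^ 2 := by
      intro l
      have h2 : (g l - w l) ^ 2 ≤ (ε * |w l| + ε / k) ^ 2 := by
        rw [← sq_abs (g l - w l)]
        gcongr
        exact hg3 l
      have h3 := sq_abs (w l)
      have h4 := sq_nonneg (ε * |w l| - ε / k)
      nlinarith
    calc ∑ l, ((WithLp.toLp 2 g - w : EuclideanSpace ℝ (Fin k)) l) ^ 2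
        ≤ ∑ l, (2 * ε ^ 2 * (w l) ^ 2 + 2 * (ε / k) ^ 2) :=
          Finset.sum_le_sum fun l _ => by simpa using h1 l
      _ = 2 * ε ^ 2 * ∑ l, (w l) ^ 2 + k * (2 * (ε / k) ^ 2) := by
          rw [Finset.sum_add_distrib, Finset.mul_sum]; simp
      _ ≤ _ := by
          have : (k : ℝ) * (2 * (ε / k) ^ 2) = 2 * ε ^ 2 / k := by field_simp
          rw [this]
          have := div_le_self (show 0 ≤ 2 * ε ^ 2 by positivity) hk'
          linarith

lemma emv_nonneg (n k : ℕ) (d : Fin n → Fin n → ℝ)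
    (x : Fin n → EuclideanSpace ℝ (Fin k)) : 0 ≤ EMV n k d x := by
  unfold EMV
  positivity

lemma opt_bdd (n k : ℕ) (d : Fin n → Fin n → ℝ) :
    BddBelow {y | ∃ x : Fin n → EuclideanSpace ℝ (Fin k), y = EMV n k d x} :=
  ⟨0, by rintro y ⟨x, rfl⟩; exact emv_nonneg n k d x⟩

lemma near_opt (n k : ℕ) (d : Fin n → Fin n → ℝ) (η : ℝ) (hη : 0 < η) :
    ∃ x, EMV n k d x ≤ OPTEMV n k d + η := by
  have hne : {y | ∃ x : Fin n → EuclideanSpace ℝ (Fin k), y = EMV n k d x}.Nonempty :=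
    ⟨_, 0, rfl⟩
  obtain ⟨y, ⟨x, rfl⟩, hy⟩ := exists_lt_of_csInf_lt hne
    (lt_add_of_pos_right (sInf _) hη)
  exact ⟨x, hy.le⟩

lemma opt_le (n k : ℕ) (d : Fin n → Fin n → ℝ) : OPTEMV n k d ≤ D2 n d := by
  have : D2 n d = EMV n k d 0 := by simp [D2, EMV]
  rw [this]
  exact csInf_le (opt_bdd n k d) ⟨0, rfl⟩

lemma opt_nonneg (n k : ℕ) (d : Fin n → Fin n → ℝ) : 0 ≤ OPTEMV n k d :=
  le_csInf ⟨_, 0, rfl⟩ (by rintro y ⟨x, rfl⟩; exact emv_nonneg n k d x)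

/-- anchoring -/
lemma anchor (n k : ℕ) (hn : 1 ≤ n) (d : Fin n → Fin n → ℝ)
    (y : Fin n → EuclideanSpace ℝ (Fin k)) (h : EMV n k d y ≤ 2 * D2 n d) :
    ∃ a, ∑ i, ‖y i - y a‖ ^ 2 ≤ n * (6 * D2 n d) := by
  have hn' : (0 : ℝ) < n := by exact_mod_cast hn
  have hsum : ∑ a, ∑ i, ‖y i - y a‖ ^ 2 ≤ (n : ℝ) ^ 2 * (6 * D2 n d) := by
    have e1 : ∑ i, ∑ j, d i j ^ 2 = (n : ℝ) ^ 2 * D2 n d := by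
      unfold D2; field_simp
    have e2 : ∑ i, ∑ j, (d i j - ‖y i - y j‖) ^ 2 = (n : ℝ) ^ 2 * EMV n k d y := by
      unfold EMV; field_simp
    rw [Finset.sum_comm]
    have : ∑ i, ∑ a, ‖y i - y a‖ ^ 2 ≤
        ∑ i, ∑ j, (2 * d i j ^ 2 + 2 * (d i j - ‖y i - y j‖) ^ 2) := by
      refine Finset.sum_le_sum fun i _ => Finset.sum_le_sum fun j _ => ?_
      nlinarith [sq_nonneg (2 * d i j - ‖y i - y j‖)]
    simp only [Finset.sum_add_distrib, ← Finset.mul_sum] at this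
    rw [e1, e2] at this
    have h2 : (n : ℝ) ^ 2 * EMV n k d y ≤ (n : ℝ) ^ 2 * (2 * D2 n d) := by gcongr
    nlinarith
  by_contra hc
  push Not at hc
  have : Nonempty (Fin n) := ⟨⟨0, hn⟩⟩
  have := Finset.sum_lt_sum_of_nonempty (s := (Finset.univ : Finset (Fin n)))
    Finset.univ_nonempty (fun a _ => hc a)
  simp only [Finset.sum_const, Finset.card_univ, Fintype.card_fin, nsmul_eq_mul] at this
  nlinarith

lemma trunc_bound (n k : ℕ) (hn : 1 ≤ n) (d : Fin n → Fin n → ℝ) (Δ ε : ℝ) (hΔ : 1 ≤ Δ)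
    (hε : 0 < ε) (hε1 : ε < 1)
    (hd0 : ∀ i j, 0 ≤ d i j) (hdΔ : ∀ i j, d i j ≤ Δ) (hD0 : 0 ≤ D2 n d)
    (hD : D2 n d ≤ Δ ^ 2)
    (z w : Fin n → EuclideanSpace ℝ (Fin k)) (hz : ∑ i, ‖z i‖ ^ 2 ≤ n * (6 * D2 n d))
    (hw : ∀ i, w i = if ‖z i‖ ≤ 10 * Δ / ε then z i else 0) :
    EMV n k d w ≤ EMV n k d z + ε * D2 n d := by
  have hn' : (0 : ℝ) < n := by exact_mod_cast hn
  set R := 10 * Δ / ε with hR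
  have hR0 : 0 < R := by positivity
  have hwz : ∀ i, ‖w i‖ ^ 2 ≤ ‖z i‖ ^ 2 := by
    intro i; rw [hw]; split_ifs
    · exact le_rfl
    · simp
  have hws : ∑ i, ‖w i‖ ^ 2 ≤ n * (6 * D2 n d) :=
    (Finset.sum_le_sum fun i _ => hwz i).trans hz
  let o : Fin n → ℝ := fun i => ‖z i‖ ^ 2 / R ^ 2
  have ho : ∀ i, 0 ≤ o i := fun i => by positivity
  have ho1 : ∀ i, ¬ ‖z i‖ ≤ R → 1 ≤ o i := by
    intro i hi
    push Not at hi
    rw [one_le_div (by positivity)]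
    gcongr
  have hp : ∀ i j, (d i j - ‖w i - w j‖) ^ 2 ≤ (d i j - ‖z i - z j‖) ^ 2 +
      o i * (Δ ^ 2 + ‖w j‖ ^ 2) + o j * (Δ ^ 2 + ‖w i‖ ^ 2) := by
    intro i j
    have hd2 : d i j ^ 2 ≤ Δ ^ 2 := by
      have := hd0 i j; have := hdΔ i j; gcongr
    have t1 : 0 ≤ o i * (Δ ^ 2 + ‖w j‖ ^ 2) := mul_nonneg (ho i) (by positivity)
    have t2 : 0 ≤ o j * (Δ ^ 2 + ‖w i‖ ^ 2) := mul_nonneg (ho j) (by positivity)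
    have t3 : 0 ≤ (d i j - ‖z i - z j‖) ^ 2 := sq_nonneg _
    by_cases hi : ‖z i‖ ≤ R
    · by_cases hj : ‖z j‖ ≤ R
      · have e1 : w i = z i := by rw [hw, if_pos hi]
        have e2 : w j = z j := by rw [hw, if_pos hj]
        have e : ‖w i - w j‖ = ‖z i - z j‖ := by rw [e1, e2]
        rw [e]
        linarith
      · have e2 : w j = 0 := by rw [hw, if_neg hj]
        have := mul_le_mul_of_nonneg_right (ho1 j hj)
          (show 0 ≤ Δ ^ 2 + ‖w i‖ ^ 2 by positivity)
        have e : ‖w i - w j‖ = ‖w i‖ := by rw [e2, sub_zero]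
        rw [e]
        nlinarith [mul_nonneg (hd0 i j) (norm_nonneg (w i))]
    · have e1 : w i = 0 := by rw [hw, if_neg hi]
      have := mul_le_mul_of_nonneg_right (ho1 i hi)
          (show 0 ≤ Δ ^ 2 + ‖w j‖ ^ 2 by positivity)
      have e : ‖w i - w j‖ = ‖w j‖ := by rw [e1, zero_sub, norm_neg]
      rw [e]
      nlinarith [mul_nonneg (hd0 i j) (norm_nonneg (w j))]
  have hs := Finset.sum_le_sum fun i (_ : i ∈ Finset.univ) =>
    Finset.sum_le_sum fun j (_ : j ∈ Finset.univ) => hp i j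
  have e3 : ∑ i, ∑ j, o j * (Δ ^ 2 + ‖w i‖ ^ 2) = ∑ i, ∑ j, o i * (Δ ^ 2 + ‖w j‖ ^ 2) :=
    Finset.sum_comm
  have e4 : ∑ i, ∑ j, o i * (Δ ^ 2 + ‖w j‖ ^ 2) =
      (∑ i, o i) * (n * Δ ^ 2 + ∑ j, ‖w j‖ ^ 2) := by
    rw [Finset.sum_mul]
    refine Finset.sum_congr rfl fun i _ => ?_
    rw [← Finset.mul_sum, Finset.sum_add_distrib]
    simp
  have hos : ∑ i, o i ≤ n * (6 * D2 n d) / R ^ 2 := by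
    simp only [o]
    rw [← Finset.sum_div]
    gcongr
  have hos0 : 0 ≤ ∑ i, o i := Finset.sum_nonneg fun i _ => ho i
  have h5 : (∑ i, o i) * (n * Δ ^ 2 + ∑ j, ‖w j‖ ^ 2) ≤
      (n * (6 * D2 n d) / R ^ 2) * (n * (7 * Δ ^ 2)) := by
    have : n * Δ ^ 2 + ∑ j, ‖w j‖ ^ 2 ≤ n * (7 * Δ ^ 2) := by nlinarith
    have : 0 ≤ ∑ j, ‖w j‖ ^ 2 := by positivity
    gcongr
  have h6 : (n * (6 * D2 n d) / R ^ 2) * (n * (7 * Δ ^ 2)) =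
      (n : ℝ) ^ 2 * (0.42 * ε ^ 2 * D2 n d) := by
    rw [hR]; field_simp; ring
  have h7 : 0.42 * ε ^ 2 * D2 n d ≤ (ε / 2) * D2 n d := by
    gcongr; nlinarith
  simp only [Finset.sum_add_distrib] at hs
  rw [e3, e4] at hs
  have h8 : ∑ i, ∑ j, (d i j - ‖w i - w j‖) ^ 2 ≤
      ∑ i, ∑ j, (d i j - ‖z i - z j‖) ^ 2 + (n : ℝ) ^ 2 * (ε * D2 n d) := by
    nlinarith [sq_nonneg (n : ℝ)]
  unfold EMV
  calc _ ≤ (1 / (n : ℝ) ^ 2) * (∑ i, ∑ j, (d i j - ‖z i - z j‖) ^ 2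
        + (n : ℝ) ^ 2 * (ε * D2 n d)) := by gcongr
    _ = _ := by field_simp

lemma perturb_s3 (n k : ℕ) (hn : 1 ≤ n) (d : Fin n → Fin n → ℝ) (ε E : ℝ)
    (hε : 0 < ε) (w x : Fin n → EuclideanSpace ℝ (Fin k))
    (h : ∑ i, ‖x i - w i‖ ^ 2 ≤ n * E) :
    EMV n k d x ≤ (1 + ε) * EMV n k d w + (1 + 1 / ε) * (4 * E) := by
  have hn' : (0 : ℝ) < n := by exact_mod_cast hn
  have hp : ∀ i j, (d i j - ‖x i - x j‖) ^ 2 ≤ (1 + ε) * (d i j - ‖w i - w j‖) ^ 2 +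
      (1 + 1 / ε) * (2 * (‖x i - w i‖ ^ 2 + ‖x j - w j‖ ^ 2)) := by
    intro i j
    have hB : |‖x i - x j‖ - ‖w i - w j‖| ≤ ‖x i - w i‖ + ‖x j - w j‖ := by
      refine (abs_norm_sub_norm_le _ _).trans ?_
      have : x i - x j - (w i - w j) = (x i - w i) - (x j - w j) := by abel
      rw [this]
      exact norm_sub_le _ _
    set A := d i j - ‖w i - w j‖
    set B := ‖x i - x j‖ - ‖w i - w j‖
    have e : d i j - ‖x i - x j‖ = A - B := by simp only [A, B]; ring
    rw [e]
    have hB2 : B ^ 2 ≤ 2 * (‖x i - w i‖ ^ 2 + ‖x j - w j‖ ^ 2) := by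
      rw [← sq_abs B]
      have : |B| ^ 2 ≤ (‖x i - w i‖ + ‖x j - w j‖) ^ 2 := by gcongr
      nlinarith [sq_nonneg (‖x i - w i‖ - ‖x j - w j‖)]
    have hAB : (A - B) ^ 2 ≤ (1 + ε) * A ^ 2 + (1 + 1 / ε) * B ^ 2 := by
      have : (1 + ε) * A ^ 2 + (1 + 1 / ε) * B ^ 2 - (A - B) ^ 2 = (ε * A + B) ^ 2 / ε := by
        field_simp; ring
      have : 0 ≤ (ε * A + B) ^ 2 / ε := by positivity
      linarith
    have : (1 + 1 / ε) * B ^ 2 ≤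
      (1 + 1 / ε) * (2 * (‖x i - w i‖ ^ 2 + ‖x j - w j‖ ^ 2)) := by gcongr
    linarith
  have hs := Finset.sum_le_sum fun i (_ : i ∈ Finset.univ) =>
    Finset.sum_le_sum fun j (_ : j ∈ Finset.univ) => hp i j
  simp only [Finset.sum_add_distrib, ← Finset.mul_sum, Finset.sum_const, Finset.card_univ,
    Fintype.card_fin, nsmul_eq_mul] at hs
  have h2 : (1 + 1 / ε) * (2 * (n * ∑ i, ‖x i - w i‖ ^ 2 + n * ∑ i, ‖x i - w i‖ ^ 2)) ≤
      (1 + 1 / ε) * (2 * (n * (n * E) + n * (n * E))) := by gcongr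
  unfold EMV
  calc _ ≤ (1 / (n : ℝ) ^ 2) * ((1 + ε) * ∑ i, ∑ j, (d i j - ‖w i - w j‖) ^ 2
        + (1 + 1 / ε) * (2 * (n * (n * E) + n * (n * E)))) := by gcongr; linarith
    _ = _ := by field_simp; ring

lemma D2_bounds (n : ℕ) (hn : 2 ≤ n) (d : Fin n → Fin n → ℝ) (Δ : ℝ)
    (hd0 : ∀ i j, 0 ≤ d i j) (hdΔ : ∀ i j, d i j ≤ Δ) (hd1 : ∀ i j, i ≠ j → 1 ≤ d i j) :
    1 / 2 ≤ D2 n d ∧ D2 n d ≤ Δ ^ 2 := by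
  have hn' : (2 : ℝ) ≤ n := by exact_mod_cast hn
  have e1 : ∑ i, ∑ j, d i j ^ 2 = (n : ℝ) ^ 2 * D2 n d := by
    unfold D2; field_simp
  constructor
  · have h : ∑ i : Fin n, ∑ j : Fin n, (1 - if i = j then (1 : ℝ) else 0) ≤
        ∑ i, ∑ j, d i j ^ 2 := by
      refine Finset.sum_le_sum fun i _ => Finset.sum_le_sum fun j _ => ?_
      split_ifs with hij
      · simpa using sq_nonneg (d i j)
      · have := hd1 i j hij
        nlinarith
    simp only [Finset.sum_sub_distrib] at h
    simp at h
    rw [e1] at h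
    by_contra hc
    push Not at hc
    nlinarith [mul_pos (show (0:ℝ) < n by linarith) (show (0:ℝ) < n by linarith)]
  · have h : ∑ i, ∑ j, d i j ^ 2 ≤ ∑ i : Fin n, ∑ j : Fin n, Δ ^ 2 := by
      refine Finset.sum_le_sum fun i _ => Finset.sum_le_sum fun j _ => ?_
      have := hd0 i j; have := hdΔ i j; gcongr
    simp at h
    rw [e1] at h
    by_contra hc
    push Not at hc
    nlinarith [mul_pos (show (0:ℝ) < n by linarith) (show (0:ℝ) < n by linarith)]

/-- existence of a discretized, anchored, variance-bounded,
near-optimal embedding. -/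
theorem stmt_3 :
    ∃ C C' : ℝ, 1 ≤ C ∧ 1 ≤ C' ∧
      ∀ (n k : ℕ), 1 ≤ n → 1 ≤ k →
      ∀ (Δ ε : ℝ), 1 ≤ Δ → 0 < ε → ε < 1 →
      ∀ d : Fin n → Fin n → ℝ,
        (∀ i j, d i j = d j i) → (∀ i j, 0 ≤ d i j) → (∀ i, d i i = 0) →
        (∀ i j, i ≠ j → 1 ≤ d i j ∧ d i j ≤ Δ) →
        ∃ (S : Finset ℝ) (a : Fin n) (x : Fin n → EuclideanSpace ℝ (Fin k)),
          (0 : ℝ) ∈ S ∧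
          (S.card : ℝ) ≤ C * (1 / ε) * Real.log (Δ * k / ε) + C ∧
          (∀ i ℓ, x i ℓ ∈ S) ∧
          x a = 0 ∧
          (1 / (n : ℝ)) * ∑ i, ‖x i‖ ^ 2 ≤ 6 * D2 n d ∧
          EMV n k d x ≤ OPTEMV n k d + C' * ε * D2 n d := by
  refine ⟨100, 200, by norm_num, by norm_num, ?_⟩
  intro n k hn hk Δ ε hΔ hε hε1 d _ hd0 hdd hd
  obtain ⟨hL, hcard⟩ := card_aux k hk Δ ε hΔ hε hε1
  have hk' : (1 : ℝ) ≤ k := by exact_mod_cast hk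
  have hn' : (0 : ℝ) < n := by exact_mod_cast hn
  rcases Nat.lt_or_ge 1 n with hn2 | hn1
  swap
  · obtain rfl : n = 1 := le_antisymm hn1 hn
    have hD : D2 1 d = 0 := by simp [D2, hdd]
    refine ⟨{0}, 0, 0, by simp, ?_, by simp, rfl, ?_, ?_⟩
    · have : 0 ≤ 100 * (1 / ε) * Real.log (Δ * k / ε) := by positivity
      simp only [Finset.card_singleton, Nat.cast_one]
      linarith
    · rw [hD]; simp
    · have := opt_nonneg 1 k d
      have h2 : EMV 1 k d 0 = 0 := by simp [EMV, hdd]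
      rw [hD, h2]; linarith
  have hdΔ : ∀ i j, d i j ≤ Δ := by
    intro i j
    by_cases h : i = j
    · subst h; rw [hdd]; linarith
    · exact (hd i j h).2
  obtain ⟨hD1, hD2⟩ := D2_bounds n hn2 d Δ hd0 hdΔ (fun i j h => (hd i j h).1)
  have hopt := opt_le n k d
  obtain ⟨y, hy⟩ := near_opt n k d (ε * D2 n d) (by positivity)
  have hεD : ε * D2 n d ≤ 1 * D2 n d := by gcongr
  obtain ⟨a, ha⟩ := anchor n k hn d y (by linarith)
  let z : Fin n → EuclideanSpace ℝ (Fin k) := fun i => y i - y a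
  let w : Fin n → EuclideanSpace ℝ (Fin k) := fun i => if ‖z i‖ ≤ 10 * Δ / ε then z i else 0
  have hzy : EMV n k d z = EMV n k d y := by
    simp only [EMV, z, sub_sub_sub_cancel_right]
  have hw := trunc_bound n k hn d Δ ε hΔ hε hε1 hd0 hdΔ (by linarith) hD2 z w ha (fun i => rfl)
  have hwz : ∀ i, ‖w i‖ ^ 2 ≤ ‖z i‖ ^ 2 := by
    intro i; simp only [w]; split_ifs
    · exact le_rfl
    · simp
  have hwR : ∀ i, ‖w i‖ ≤ 10 * Δ / ε := by
    intro i; simp only [w]; split_ifs with h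
    · exact h
    · simp; positivity
  have hws : ∑ i, ‖w i‖ ^ 2 ≤ n * (6 * D2 n d) :=
    (Finset.sum_le_sum fun i _ => hwz i).trans ha
  have hτR : ε / k ≤ 10 * Δ / ε := by
    have h1 : ε / k ≤ ε := div_le_self hε.le hk'
    have h2 : 10 * Δ ≤ 10 * Δ / ε := by
      rw [le_div_iff₀ hε]; nlinarith
    linarith
  obtain ⟨S, hS0, hSc, hS⟩ := grid_aux (ε / k) ε (10 * Δ / ε) (by positivity) hε hε1 hτR
  have hr := fun i => round_vec k hk ε _ hε S hS (w i) (hwR i)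
  choose x hx1 hx2 hx3 using hr
  have hwa : w a = 0 := by simp [w, z]
  have hxa : x a = 0 := by
    have := hx2 a
    rw [hwa] at this
    simp only [norm_zero, ne_eq, OfNat.ofNat_ne_zero, not_false_eq_true, zero_pow] at this
    have h0 : ‖x a‖ = 0 := by
      have h1 := sq_nonneg ‖x a‖
      exact pow_eq_zero_iff (two_ne_zero) |>.1 (le_antisymm this h1)
    exact norm_eq_zero.1 h0
  refine ⟨S, a, x, hS0, hSc.trans hcard, hx1, hxa, ?_, ?_⟩
  · have h1 : ∑ i, ‖x i‖ ^ 2 ≤ n * (6 * D2 n d) :=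
      (Finset.sum_le_sum fun i _ => hx2 i).trans hws
    calc _ ≤ (1 / (n : ℝ)) * (n * (6 * D2 n d)) := by gcongr
      _ = _ := by field_simp
  · have h1 : ∑ i, ‖x i - w i‖ ^ 2 ≤ n * (16 * ε ^ 2 * D2 n d) := by
      refine (Finset.sum_le_sum fun i _ => hx3 i).trans ?_
      rw [Finset.sum_add_distrib, ← Finset.mul_sum]
      simp only [Finset.sum_const, Finset.card_univ, Fintype.card_fin, nsmul_eq_mul]
      have h2 : 2 * ε ^ 2 * ∑ i, ‖w i‖ ^ 2 ≤ 2 * ε ^ 2 * (n * (6 * D2 n d)) := by gcongr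
      have h3 : n * (2 * ε ^ 2) * 1 ≤ n * (2 * ε ^ 2) * (2 * D2 n d) := by
        gcongr; linarith
      linarith
    have h4 := perturb_s3 n k hn d ε _ hε w x h1
    have e : (1 + 1 / ε) * (4 * (16 * ε ^ 2 * D2 n d)) = 64 * (ε + 1) * (ε * D2 n d) := by
      field_simp; ring
    rw [e] at h4
    have h5 : EMV n k d w ≤ OPTEMV n k d + 2 * (ε * D2 n d) := by linarith
    have h6 : ε * EMV n k d w ≤ ε * (3 * D2 n d) := by gcongr; linarith
    have h7 : 0 ≤ ε * D2 n d := by positivity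
    nlinarith
end

section
/- Let 0 < δ ≤ 1 and let w be a (δ·n)-regular weighted graph on Fin n. Then for every integer k ≥ 1 and every family A_1, …, A_k of pairwise disjoint nonempty subsets of Fin n, there exists t ∈ {1,…,k} with φ(A_t) ≥ 1 − 1/(δ·k); equivalently, the k-way conductance ρ(k) = min over such families of max_t φ(A_t) satisfies ρ(k) ≥ 1 − 1/(δ·k). -/
/-- lower bound on multi-way conductance of dense regular weighted graphs. -/
theorem stmt_4 (n : ℕ) (δ : ℝ) (hδ0 : 0 < δ) (hδ1 : δ ≤ 1)
    (w : Fin n → Fin n → ℝ)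
    (hsymm : ∀ i j, w i j = w j i)
    (hw0 : ∀ i j, 0 ≤ w i j) (hw1 : ∀ i j, w i j ≤ 1)
    (hdiag : ∀ i, w i i = 0)
    (hreg : ∀ i, ∑ j, w i j = δ * n)
    (k : ℕ) (hk : 1 ≤ k)
    (A : Fin k → Finset (Fin n))
    (hdisj : ∀ s t, s ≠ t → Disjoint (A s) (A t))
    (hne : ∀ t, (A t).Nonempty) :
    ∃ t : Fin k,
      (∑ i ∈ A t, ∑ j ∈ (A t)ᶜ, w i j) / (∑ i ∈ A t, ∑ j, w i j)
        ≥ 1 - 1 / (δ * k) := by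
  classical
  have hcard : ∑ t, (A t).card ≤ n := by
    rw [← Finset.card_biUnion (fun s _ t _ h => hdisj s t h)]
    simpa using Finset.card_le_univ (Finset.univ.biUnion A)
  have hex : ∃ t, k * (A t).card ≤ n := by
    by_contra! h
    have h1 : ∑ _t : Fin k, n < ∑ t, k * (A t).card :=
      Finset.sum_lt_sum_of_nonempty ⟨⟨0, hk⟩, Finset.mem_univ _⟩ (fun t _ => h t)
    rw [← Finset.mul_sum] at h1
    simp at h1
    have := Nat.mul_le_mul_left k hcard
    omega
  obtain ⟨t, ht⟩ := hex
  refine ⟨t, ?_⟩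
  have ha : (0 : ℝ) < (A t).card := by exact_mod_cast (hne t).card_pos
  have hk0 : (0 : ℝ) < k := by exact_mod_cast hk
  have ht' : (k : ℝ) * (A t).card ≤ n := by exact_mod_cast ht
  have hn : (0 : ℝ) < n := lt_of_lt_of_le (by positivity) ht'
  have hvol : ∑ i ∈ A t, ∑ j, w i j = (A t).card * (δ * n) := by
    simp [hreg]
  have hin : ∑ i ∈ A t, ∑ j ∈ A t, w i j ≤ (A t).card * (A t).card := by
    calc ∑ i ∈ A t, ∑ j ∈ A t, w i j ≤ ∑ i ∈ A t, ∑ j ∈ A t, (1 : ℝ) :=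
          Finset.sum_le_sum fun i _ => Finset.sum_le_sum fun j _ => hw1 i j
      _ = _ := by simp
  have hsplit : ∑ i ∈ A t, ∑ j ∈ A t, w i j + ∑ i ∈ A t, ∑ j ∈ (A t)ᶜ, w i j
      = (A t).card * (δ * n) := by
    rw [← hvol, ← Finset.sum_add_distrib]
    exact Finset.sum_congr rfl fun i _ => Finset.sum_add_sum_compl _ _
  rw [hvol, ge_iff_le, le_div_iff₀ (by positivity)]
  have h2 : 1 / (δ * k) * ((A t).card * (δ * n)) = (A t).card * n / k := by
    field_simp
  have h3 : ((A t).card : ℝ) * (A t).card ≤ (A t).card * n / k := by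
    rw [le_div_iff₀ hk0]
    nlinarith
  rw [sub_mul, h2]
  linarith
end

section
/- There are absolute constants c > 0 and C ≥ 1 such that the following holds. Let n ≥ 1, 0 < δ ≤ 1, and let w be a (δ·n)-regular weighted graph on Fin n. Then there exist an integer k with 1 ≤ k ≤ C/δ² and a partition of Fin n into nonempty sets P_1, …, P_k such that: (1) for every t and every S ⊆ P_t with 0 < vol_{P_t}(S) ≤ vol_{P_t}(P_t)/2, one has E(S, P_t∖S) ≥ c·δ^{10}·vol_{P_t}(S) (i.e., the induced subgraph G[P_t] has conductance at least c·δ^{10}); (2) E(P_t, P_tᶜ) ≤ (1/4)·vol(P_t) for every t; and (3) ∑_{t ≠ t'} E(P_t, P_{t'}) ≤ (1/2)·∑_{i,j ∈ Fin n} w i j. -/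
namespace ExpDec
open Finset

noncomputable section

/-- total weight between two sets -/
def E {n : ℕ} (w : Fin n → Fin n → ℝ) (A B : Finset (Fin n)) : ℝ :=
  ∑ i ∈ A, ∑ j ∈ B, w i j

/-- fiber of a colouring -/
def fib {n : ℕ} (f : Fin n → Fin n) (a : Fin n) : Finset (Fin n) :=
  univ.filter (fun i => f i = a)

/-- number of colours used -/
def K {n : ℕ} (f : Fin n → Fin n) : ℕ := (univ.image f).card

/-- boundary, for a graph of degree D -/
def B {n : ℕ} (w : Fin n → Fin n → ℝ) (D : ℝ) (A : Finset (Fin n)) : ℝ :=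
  D * A.card - E w A A

/-- recolour S by b -/
def upd {n : ℕ} (f : Fin n → Fin n) (S : Finset (Fin n)) (b : Fin n) : Fin n → Fin n :=
  fun i => if i ∈ S then b else f i

variable {n : ℕ} {w : Fin n → Fin n → ℝ}

lemma E_comm (hs : ∀ i j, w i j = w j i) (A C : Finset (Fin n)) : E w A C = E w C A := by
  unfold E
  rw [sum_comm]
  exact sum_congr rfl fun i _ => sum_congr rfl fun j _ => hs _ _

lemma E_union_left {A A' : Finset (Fin n)} (C : Finset (Fin n)) (h : Disjoint A A') :
    E w (A ∪ A') C = E w A C + E w A' C := by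
  unfold E; rw [sum_union h]

lemma E_union_right {A A' : Finset (Fin n)} (C : Finset (Fin n)) (h : Disjoint A A') :
    E w C (A ∪ A') = E w C A + E w C A' := by
  unfold E; rw [← sum_add_distrib]
  exact sum_congr rfl fun i _ => sum_union h

lemma E_nonneg (h0 : ∀ i j, 0 ≤ w i j) (A C : Finset (Fin n)) : 0 ≤ E w A C :=
  sum_nonneg fun i _ => sum_nonneg fun j _ => h0 i j

lemma E_univ {D : ℝ} (hr : ∀ i, ∑ j, w i j = D) (A : Finset (Fin n)) :
    E w A univ = D * A.card := by
  unfold E; simp [hr, mul_comm]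

lemma E_le {D : ℝ} (h0 : ∀ i j, 0 ≤ w i j) (hr : ∀ i, ∑ j, w i j = D)
    (A C : Finset (Fin n)) : E w A C ≤ D * A.card := by
  rw [← E_univ hr]
  exact sum_le_sum fun i _ => sum_le_sum_of_subset_of_nonneg (subset_univ _) fun j _ _ => h0 i j

lemma E_self_le (h1 : ∀ i j, w i j ≤ 1) (A : Finset (Fin n)) :
    E w A A ≤ (A.card : ℝ) * A.card := by
  calc E w A A ≤ ∑ i ∈ A, ∑ j ∈ A, (1:ℝ) := sum_le_sum fun i _ => sum_le_sum fun j _ => h1 i j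
    _ = _ := by simp

lemma B_eq {D : ℝ} (hr : ∀ i, ∑ j, w i j = D) (A : Finset (Fin n)) :
    E w A Aᶜ = B w D A := by
  have := E_univ hr A
  rw [← union_compl A, E_union_right _ disjoint_compl_right] at this
  unfold B; linarith

lemma B_union {D : ℝ} (hs : ∀ i j, w i j = w j i) {A C : Finset (Fin n)} (h : Disjoint A C) :
    B w D (A ∪ C) = B w D A + B w D C - 2 * E w A C := by
  unfold B
  rw [E_union_left _ h, E_union_right _ h, E_union_right _ h, card_union_of_disjoint h,
    E_comm hs C A]
  push_cast; ring

lemma mem_fib {f : Fin n → Fin n} {a i : Fin n} : i ∈ fib f a ↔ f i = a := by simp [fib]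

lemma fib_upd_b {f : Fin n → Fin n} {S : Finset (Fin n)} {b : Fin n} :
    fib (upd f S b) b = S ∪ fib f b := by
  ext i; simp only [mem_fib, upd, mem_union]; split_ifs <;> simp_all

lemma fib_upd_a {f : Fin n → Fin n} {S : Finset (Fin n)} {a b : Fin n} (hab : b ≠ a) :
    fib (upd f S b) a = fib f a \ S := by
  ext i; simp only [mem_fib, upd, mem_sdiff]; split_ifs <;> simp_all

lemma fib_upd_c {f : Fin n → Fin n} {S : Finset (Fin n)} {a b x : Fin n} (hS : S ⊆ fib f a)
    (ha : x ≠ a) (hb : x ≠ b) :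
    fib (upd f S b) x = fib f x := by
  ext i
  have := @hS i
  simp only [mem_fib, upd] at *
  split_ifs with h
  · have := this h
    constructor
    · intro h; exact absurd h.symm hb
    · intro h; exact absurd (h.symm.trans this) ha
  · rfl

lemma sum_upd {D : ℝ} (hs : ∀ i j, w i j = w j i) {f : Fin n → Fin n} {S : Finset (Fin n)}
    {a b : Fin n} (hS : S ⊆ fib f a) (hab : b ≠ a) :
    ∑ x, B w D (fib (upd f S b) x) =
      ∑ x, B w D (fib f x) + 2 * E w S (fib f a \ S) - 2 * E w S (fib f b) := by
  have key : ∑ x, (B w D (fib (upd f S b) x) - B w D (fib f x)) =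
      (B w D (fib (upd f S b) a) - B w D (fib f a)) +
      (B w D (fib (upd f S b) b) - B w D (fib f b)) := by
    apply Fintype.sum_eq_add a b hab.symm
    rintro x ⟨h1, h2⟩
    rw [fib_upd_c hS h1 h2, sub_self]
  rw [sum_sub_distrib, fib_upd_a hab, fib_upd_b] at key
  have hd : Disjoint S (fib f b) := by
    rw [Finset.disjoint_left]
    intro i h1 h2
    have := hS h1
    rw [mem_fib] at this h2
    exact hab (h2.symm.trans this)
  have h1 := B_union (D := D) hs hd
  have h2 := B_union (D := D) hs (disjoint_sdiff (s := S) (t := fib f a))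
  rw [union_sdiff_of_subset hS] at h2
  linarith

lemma mem_img {f : Fin n → Fin n} {x : Fin n} : x ∈ univ.image f ↔ (fib f x).Nonempty := by
  simp [Finset.Nonempty, mem_fib]

lemma img_upd {f : Fin n → Fin n} {S : Finset (Fin n)}
    {a b : Fin n} (hS : S ⊆ fib f a) (hab : b ≠ a) (hT : (fib f a \ S).Nonempty)
    (hSn : S.Nonempty) : insert b (univ.image f) ⊆ univ.image (upd f S b) := by
  intro x hx
  rw [mem_insert] at hx
  rw [mem_img]
  by_cases hb : x = b
  · subst hb; rw [fib_upd_b]; exact hSn.mono subset_union_left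
  · have hx := hx.resolve_left hb
    by_cases ha : x = a
    · subst ha; rw [fib_upd_a hab]; exact hT
    · rw [fib_upd_c hS ha hb]; exact mem_img.1 hx

lemma sum_card_fib (f : Fin n → Fin n) : ∑ x ∈ univ.image f, (fib f x).card = n := by
  have := card_eq_sum_card_image f (univ : Finset (Fin n))
  simp only [card_univ, Fintype.card_fin] at this
  exact this.symm

lemma sum_E_fib (f : Fin n → Fin n) (S : Finset (Fin n)) :
    ∑ x ∈ univ.image f, E w S (fib f x) = E w S univ := by
  unfold E
  rw [sum_comm]
  refine sum_congr rfl fun i _ => ?_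
  exact sum_fiberwise_of_maps_to (fun j hj => mem_image_of_mem f hj) _

set_option maxHeartbeats 2000000 in
lemma core (hn : 1 ≤ n) {δ : ℝ} (hδ : 0 < δ) (hδ1 : δ ≤ 1)
    (hs : ∀ i j, w i j = w j i) (h0 : ∀ i j, 0 ≤ w i j) (h1 : ∀ i j, w i j ≤ 1)
    (hr : ∀ i, ∑ j, w i j = δ * n) :
    ∃ f : Fin n → Fin n, (K f : ℝ) * δ ≤ 4 / 3 ∧
      (∀ a, B w (δ * n) (fib f a) ≤ 1 / 4 * (δ * n * (fib f a).card)) ∧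
      ∀ a, ∀ S ⊆ fib f a, 0 < E w S (fib f a) → E w S (fib f a) ≤ E w (fib f a) (fib f a) / 2 →
        1 / 128 * δ ^ 10 * E w S (fib f a) ≤ E w S (fib f a \ S) := by
  classical
  have hnR : (0:ℝ) < n := by exact_mod_cast hn
  set D : ℝ := δ * n with hD
  have hDpos : 0 < D := by positivity
  set lam : ℝ := 3 / 128 * δ ^ 3 * n ^ 2 with hlam
  have hlampos : 0 < lam := by positivity
  let good : (Fin n → Fin n) → Prop := fun f => ∀ a, B w D (fib f a) ≤ 1 / 4 * (D * (fib f a).card)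
  let F : (Fin n → Fin n) → ℝ := fun f => ∑ x, B w D (fib f x) - lam * K f
  let z : Fin n := ⟨0, hn⟩
  have hz1 : fib (fun _ => z) z = univ := by ext; simp [mem_fib]
  have hz2 : ∀ a, a ≠ z → fib (fun _ : Fin n => z) a = ∅ := by
    intro a ha; ext; simp [mem_fib, ha.symm]
  have hBu : B w D univ = 0 := by unfold B; rw [E_univ hr]; ring
  have hBe : B w D ∅ = 0 := by simp [B, E]
  have hBz : ∀ a, B w D (fib (fun _ : Fin n => z) a) = 0 := by
    intro a
    by_cases ha : a = z
    · rw [ha, hz1, hBu]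
    · rw [hz2 a ha, hBe]
  have hzgood : good (fun _ => z) := by
    intro a; rw [hBz]; positivity
  have hzK : K (fun _ : Fin n => z) = 1 := by
    unfold K
    rw [image_const ⟨z, mem_univ _⟩]; simp
  obtain ⟨f, hfg, hmin⟩ := exists_min_image (univ.filter good) F ⟨_, by simpa using hzgood⟩
  simp only [mem_filter, mem_univ, true_and] at hfg hmin
  have hFz := hmin _ hzgood
  -- sizes
  have hBnn : ∀ A, 0 ≤ B w D A := fun A => by rw [← B_eq hr]; exact E_nonneg h0 _ _
  have hsize : ∀ a, (fib f a).Nonempty → 3 / 4 * D ≤ (fib f a).card := by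
    intro a ha
    have hc : (0:ℝ) < (fib f a).card := by exact_mod_cast ha.card_pos
    have e1 := hfg a
    have e2 := E_self_le h1 (fib f a)
    unfold B at e1
    have : (3 / 4 * D) * (fib f a).card ≤ (fib f a).card * (fib f a).card := by linarith
    exact le_of_mul_le_mul_right this hc
  have hK : (K f : ℝ) * δ ≤ 4 / 3 := by
    have e : ((∑ x ∈ univ.image f, (fib f x).card : ℕ) : ℝ) = n := by rw [sum_card_fib]
    push_cast at e
    have e2 : ∑ x ∈ univ.image f, (3 / 4 * D) ≤ ∑ x ∈ univ.image f, ((fib f x).card : ℝ) :=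
      sum_le_sum fun x hx => hsize x (mem_img.1 hx)
    rw [e, sum_const, nsmul_eq_mul] at e2
    change (K f : ℝ) * _ ≤ _ at e2
    have : ((K f : ℝ) * δ) * n ≤ 4 / 3 * n := by rw [hD] at e2; linarith
    exact le_of_mul_le_mul_right this hnR
  have hcross : ∑ x, B w D (fib f x) ≤ 1 / 32 * D ^ 2 := by
    simp only [F, hBz, hzK, sum_const_zero] at hFz
    have : lam * K f ≤ 1 / 32 * D ^ 2 := by
      have : lam * K f = 3 / 128 * D ^ 2 * (K f * δ) := by rw [hlam, hD]; ring
      rw [this]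
      nlinarith [sq_nonneg D]
    push_cast at hFz
    linarith
  have hBle : ∀ x, B w D (fib f x) ≤ 1 / 32 * D ^ 2 := fun x =>
    (single_le_sum (f := fun x => B w D (fib f x)) (fun y _ => hBnn _) (mem_univ x)).trans hcross
  refine ⟨f, hK, hfg, ?_⟩
  intro a S hS hpos hhalf
  by_contra! hlt
  -- basic quantities
  set P := fib f a with hP
  set T := P \ S with hT
  have hdST : Disjoint S T := disjoint_sdiff
  have hPu : S ∪ T = P := union_sdiff_of_subset hS
  have hESP : E w S P = E w S S + E w S T := by rw [← hPu, E_union_right _ hdST]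
  have hETP : E w T P = E w S T + E w T T := by
    rw [← hPu, E_union_right _ hdST, E_comm hs T S]
  have hEPP : E w P P = E w S P + E w T P := by
    conv_lhs => rw [← hPu]
    rw [E_union_left _ hdST, hPu]
  have hSn : S.Nonempty := by
    rw [nonempty_iff_ne_empty]; rintro rfl; simp [E] at hpos
  have hTn : T.Nonempty := by
    rw [nonempty_iff_ne_empty]; intro h
    rw [h] at hEPP; simp only [E, sum_empty] at hEPP hpos hhalf; linarith
  have hPn : P.Nonempty := hSn.mono hS
  have hPc := hsize a hPn
  have hPB := hfg a
  rw [← hP] at hPB hPc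
  have hST0 : 0 ≤ E w S T := E_nonneg h0 _ _
  have hSle := E_le h0 hr S P
  have hTle := E_le h0 hr T P
  have hp10 : δ ^ 10 ≤ δ := by
    calc δ ^ 10 ≤ δ ^ 1 := pow_le_pow_of_le_one hδ.le hδ1 (by norm_num)
      _ = δ := pow_one δ
  have hp2 : δ ^ 10 ≤ δ ^ 2 := pow_le_pow_of_le_one hδ.le hδ1 (by norm_num)
  have hlt1 : E w S T ≤ 1 / 128 * δ * E w S P := hlt.le.trans (by gcongr)
  have hlt2 : E w S T ≤ 1 / 128 * E w S P := by
    have := mul_le_mul_of_nonneg_right hδ1 hpos.le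
    linarith
  have hlt3 : E w S T < 1 / 128 * δ ^ 2 * E w S P := hlt.trans_le (by gcongr)
  have hBP : B w D P = B w D S + B w D T - 2 * E w S T := by rw [← hPu, B_union hs hdST]
  have hTbig : 9 / 32 * D ^ 2 ≤ D * T.card := by
    have e1 : 3 / 4 * (D * P.card) ≤ E w P P := by unfold B at hPB; linarith
    have e2 : 3 / 4 * D * D ≤ D * P.card := by
      have := mul_le_mul_of_nonneg_left hPc hDpos.le
      linarith
    have e3 : D ^ 2 = D * D := sq D
    linarith
  have hTgood : B w D T ≤ 1 / 4 * (D * T.card) := by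
    have e1 : E w S S + E w S T ≤ D * S.card := by linarith
    have e2 : B w D T ≤ B w D P + E w S T := by
      rw [hBP]; unfold B; linarith
    have := hBle a
    rw [← hP] at this
    have : E w S P ≤ D * T.card := by linarith
    linarith
  have hBS : B w D S ≤ E w S T + 1 / 32 * D ^ 2 := by
    have := hBle a
    rw [← hP, hBP] at this
    have : E w S T ≤ B w D T := by unfold B; linarith
    linarith
  by_cases hSgood : B w D S ≤ 1 / 4 * (D * S.card)
  · -- split off S with a new colour
    have hnotinj : ¬ Function.Injective f := by
      intro hi
      obtain ⟨s, hs'⟩ := hSn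
      obtain ⟨t, ht⟩ := hTn
      have q1 := mem_fib.1 (hS hs')
      have q2 := mem_fib.1 (mem_sdiff.1 ht).1
      have : s = t := hi (q1.trans q2.symm)
      subst this
      exact (mem_sdiff.1 ht).2 hs'
    rw [Finite.injective_iff_surjective] at hnotinj
    unfold Function.Surjective at hnotinj
    push Not at hnotinj
    obtain ⟨b, hb⟩ := hnotinj
    have hab : b ≠ a := by
      rintro rfl
      obtain ⟨s, hs'⟩ := hSn
      exact hb s (mem_fib.1 (hS hs'))
    have hbe : fib f b = ∅ := by ext i; simp [mem_fib, hb i]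
    have hg : good (upd f S b) := by
      intro x
      by_cases hxb : x = b
      · subst hxb; rw [fib_upd_b, hbe, union_empty]; exact hSgood
      · by_cases hxa : x = a
        · subst hxa; rw [fib_upd_a hab]; exact hTgood
        · rw [fib_upd_c hS hxa hxb]; exact hfg x
    have hm := hmin _ hg
    have hk : K f + 1 ≤ K (upd f S b) := by
      have := card_le_card (img_upd hS hab hTn hSn)
      rw [card_insert_of_notMem (by simpa using hb)] at this
      exact this
    have hkR : (K f : ℝ) + 1 ≤ K (upd f S b) := by exact_mod_cast hk
    simp only [F] at hm
    rw [sum_upd hs hS hab, hbe] at hm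
    have hz : E w S ∅ = 0 := by simp [E]
    rw [hz, ← hP, ← hT] at hm
    have h2 : lam ≤ 2 * E w S T := by
      have := mul_le_mul_of_nonneg_left hkR hlampos.le
      linarith
    have h3 : (S.card : ℝ) ≤ n := by
      have := card_le_univ S
      rw [Fintype.card_fin] at this
      exact_mod_cast this
    have h4 : E w S P ≤ D * n := hSle.trans (by gcongr)
    have h5 : 1 / 128 * δ ^ 2 * E w S P ≤ 1 / 128 * δ ^ 2 * (D * n) := by gcongr
    have h6 : 1 / 128 * δ ^ 2 * (D * n) = lam / 3 := by rw [hlam, hD]; ring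
    linarith
  · push Not at hSgood
    have hmove : ∀ b ∈ (univ.image f).erase a, E w S (fib f b) ≤ E w S T := by
      intro b hb
      have hab := (mem_erase.1 hb).1
      have hbi := (mem_erase.1 hb).2
      have hbn := hsize b (mem_img.1 hbi)
      have hd : Disjoint S (fib f b) := by
        rw [Finset.disjoint_left]
        intro i h1 h2
        have := hS h1
        rw [mem_fib] at this h2
        exact hab (h2.symm.trans this)
      have hg : good (upd f S b) := by
        intro x
        by_cases hxb : x = b
        · subst hxb
          rw [fib_upd_b, B_union hs hd, card_union_of_disjoint hd]
          have := hBle x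
          have := E_nonneg h0 S (fib f x)
          push_cast
          have q := mul_le_mul_of_nonneg_left hbn hDpos.le
          have e3 : D ^ 2 = D * D := sq D
          have e4 : 0 ≤ D * D := by positivity
          linarith
        · by_cases hxa : x = a
          · subst hxa; rw [fib_upd_a hab]; exact hTgood
          · rw [fib_upd_c hS hxa hxb]; exact hfg x
      have hm := hmin _ hg
      have hk : K f ≤ K (upd f S b) :=
        card_le_card ((subset_insert _ _).trans (img_upd hS hab hTn hSn))
      have hkR : (K f : ℝ) ≤ K (upd f S b) := by exact_mod_cast hk
      simp only [F] at hm
      rw [sum_upd hs hS hab] at hm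
      rw [← hP, ← hT] at hm
      have := mul_le_mul_of_nonneg_left hkR hlampos.le
      linarith
    have ha : a ∈ univ.image f := mem_img.2 hPn
    have e1 := sum_E_fib (w := w) f S
    rw [E_univ hr, ← add_sum_erase _ _ ha, ← hP] at e1
    have e2 := sum_le_sum hmove
    rw [sum_const, nsmul_eq_mul, card_erase_of_mem ha] at e2
    have hkpos : 1 ≤ (univ.image f).card := card_pos.2 ⟨a, ha⟩
    rw [Nat.cast_sub hkpos] at e2
    change _ ≤ ((K f : ℝ) - _) * _ at e2
    push_cast at e2
    have e3 : B w D S ≤ K f * E w S T := by unfold B; linarith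
    have e4 : (K f : ℝ) * E w S T ≤ K f * (1 / 128 * δ * E w S P) := by gcongr
    have e5 : (K f : ℝ) * (1 / 128 * δ * E w S P) ≤ 4 / 3 * (1 / 128 * E w S P) := by
      have := mul_le_mul_of_nonneg_right hK hpos.le
      linarith
    linarith

end

end ExpDec


open ExpDec Finset in
/-- expander decomposition of dense regular weighted graphs. -/
theorem stmt_5 :
    ∃ c C : ℝ, 0 < c ∧ 1 ≤ C ∧
      ∀ (n : ℕ), 1 ≤ n →
      ∀ (δ : ℝ), 0 < δ → δ ≤ 1 →
      ∀ w : Fin n → Fin n → ℝ,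
        (∀ i j, w i j = w j i) → (∀ i j, 0 ≤ w i j) → (∀ i j, w i j ≤ 1) →
        (∀ i, w i i = 0) → (∀ i, ∑ j, w i j = δ * n) →
        ∃ (k : ℕ) (P : Fin k → Finset (Fin n)),
          1 ≤ k ∧ (k : ℝ) ≤ C / δ ^ 2 ∧
          (∀ t, (P t).Nonempty) ∧
          (∀ s t, s ≠ t → Disjoint (P s) (P t)) ∧
          (∀ i, ∃ t, i ∈ P t) ∧
          (∀ t, ∀ S ⊆ P t,
            0 < ∑ i ∈ S, ∑ j ∈ P t, w i j →
            ∑ i ∈ S, ∑ j ∈ P t, w i j ≤ (∑ i ∈ P t, ∑ j ∈ P t, w i j) / 2 →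
            ∑ i ∈ S, ∑ j ∈ P t \ S, w i j ≥ c * δ ^ 10 * ∑ i ∈ S, ∑ j ∈ P t, w i j) ∧
          (∀ t, ∑ i ∈ P t, ∑ j ∈ (P t)ᶜ, w i j ≤ (1 / 4) * ∑ i ∈ P t, ∑ j, w i j) ∧
          (∑ t, ∑ t' ∈ Finset.univ.filter (fun t' => t' ≠ t), ∑ i ∈ P t, ∑ j ∈ P t', w i j
            ≤ (1 / 2) * ∑ i, ∑ j, w i j) := by

  refine ⟨1 / 128, 4 / 3, by norm_num, by norm_num, ?_⟩
  intro n hn δ hδ hδ1 w hs h0 h1 _ hr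
  obtain ⟨f, hK, hB, hC⟩ := core hn hδ hδ1 hs h0 h1 hr
  let e := (univ.image f).equivFin.symm
  have hdis : ∀ s t : Fin (univ.image f).card, s ≠ t →
      Disjoint (fib f (e s)) (fib f (e t)) := by
    intro s t hst
    rw [Finset.disjoint_left]
    intro i h1 h2
    rw [mem_fib] at h1 h2
    exact hst (e.injective (Subtype.ext (h1.symm.trans h2)))
  have hB' : ∀ a, ∑ i ∈ fib f a, ∑ j ∈ (fib f a)ᶜ, w i j
      ≤ (1 / 4) * ∑ i ∈ fib f a, ∑ j, w i j := by
    intro a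
    have q := hB a
    rw [← B_eq hr, ← E_univ hr] at q
    exact q
  refine ⟨(univ.image f).card, fun t => fib f (e t), ?_, ?_, ?_, hdis, ?_, ?_, ?_, ?_⟩
  · exact card_pos.2 ⟨f ⟨0, hn⟩, mem_image_of_mem _ (mem_univ _)⟩
  · rw [le_div_iff₀ (by positivity)]
    change (K f : ℝ) * _ ≤ _
    nlinarith
  · intro t; exact mem_img.1 (e t).2
  · intro i
    refine ⟨e.symm ⟨f i, mem_image_of_mem _ (mem_univ _)⟩, ?_⟩
    simp [mem_fib]
  · intro t S hS hp hh
    exact hC _ S hS hp hh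
  · intro t; exact hB' _
  · have a1 : ∀ t : Fin (univ.image f).card,
        ∑ t' ∈ univ.filter (fun t' => t' ≠ t), ∑ i ∈ fib f (e t), ∑ j ∈ fib f (e t'), w i j
          ≤ (1 / 4) * ∑ i ∈ fib f (e t), ∑ j, w i j := by
      intro t
      refine le_trans ?_ (hB' (e t))
      rw [sum_comm]
      refine sum_le_sum fun i _ => ?_
      rw [← sum_biUnion (fun s _ t _ h => hdis s t h)]
      refine sum_le_sum_of_subset_of_nonneg ?_ fun j _ _ => h0 i j
      intro j hj
      obtain ⟨t', ht', hj⟩ := mem_biUnion.1 hj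
      rw [mem_compl]
      exact Finset.disjoint_left.1 (hdis t' t (mem_filter.1 ht').2) hj
    have a2 : ∑ t : Fin (univ.image f).card, ∑ i ∈ fib f (e t), ∑ j, w i j ≤ ∑ i, ∑ j, w i j := by
      rw [← sum_biUnion (fun s _ t _ h => hdis s t h)]
      exact sum_le_sum_of_subset_of_nonneg (subset_univ _)
        fun i _ _ => sum_nonneg fun j _ => h0 i j
    have a3 := sum_le_sum (s := univ) fun t _ => a1 t
    rw [← mul_sum] at a3
    have a4 : 0 ≤ ∑ i, ∑ j, w i j := sum_nonneg fun i _ => sum_nonneg fun j _ => h0 i j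
    refine a3.trans ?_
    linarith
end

section
/- Let p ≥ 2 be an even integer, let A : Fin n → Fin m → ℝ, and suppose u₀ : Fin n → ℝ and v₀ : Fin m → ℝ satisfy ∑_{i,j} (A i j − u₀ i · v₀ j)^p ≤ ∑_{i,j} (A i j)^p. Then there exist u : Fin n → ℝ and v : Fin m → ℝ with u i · v j = u₀ i · v₀ j for all i, j (hence the same objective value), such that: (1) ∑_i (u i)^p = ∑_j (v j)^p ≤ 2^{p−1} · (∑_{i,j} (A i j)^p)^{1/2}, and (2) ∑_{i,j} (u i)^p · (v j)^p ≤ 2^p · ∑_{i,j} (A i j)^p. -/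
/-- rescaling a rank-one solution with bounded objective so that the factor
norms are balanced and bounded. -/
theorem stmt_6 (n m : ℕ) (hn : 1 ≤ n) (hm : 1 ≤ m)
    (p : ℕ) (hp : 2 ≤ p) (hpe : Even p)
    (A : Fin n → Fin m → ℝ) (u₀ : Fin n → ℝ) (v₀ : Fin m → ℝ)
    (h : ∑ i, ∑ j, (A i j - u₀ i * v₀ j) ^ p ≤ ∑ i, ∑ j, (A i j) ^ p) :
    ∃ (u : Fin n → ℝ) (v : Fin m → ℝ),
      (∀ i j, u i * v j = u₀ i * v₀ j) ∧
      (∑ i, u i ^ p = ∑ j, v j ^ p) ∧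
      (∑ i, u i ^ p ≤ 2 ^ (p - 1) * Real.sqrt (∑ i, ∑ j, (A i j) ^ p)) ∧
      (∑ i, ∑ j, u i ^ p * v j ^ p ≤ 2 ^ p * ∑ i, ∑ j, (A i j) ^ p) := by
  have hp0 : p ≠ 0 := by omega
  have hS : 0 ≤ ∑ i, ∑ j, (A i j) ^ p :=
    Finset.sum_nonneg fun i _ => Finset.sum_nonneg fun j _ => hpe.pow_nonneg _
  set S := ∑ i, ∑ j, (A i j) ^ p with hSdef
  have key : ∑ i, ∑ j, (u₀ i * v₀ j) ^ p ≤ 2 ^ p * S := by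
    have h1 : ∑ i, ∑ j, (u₀ i * v₀ j) ^ p ≤
        ∑ i, ∑ j, 2 ^ (p - 1) * ((A i j) ^ p + (A i j - u₀ i * v₀ j) ^ p) := by
      refine Finset.sum_le_sum fun i _ => Finset.sum_le_sum fun j _ => ?_
      have := hpe.add_pow_le (a := A i j) (b := -(A i j - u₀ i * v₀ j))
      rw [hpe.neg_pow] at this
      convert this using 2
      ring
    simp only [← Finset.mul_sum, Finset.sum_add_distrib] at h1
    have h2 : (2 : ℝ) ^ p = 2 ^ (p - 1) * 2 := by
      rw [← pow_succ]; congr 1; omega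
    have h3 : (0 : ℝ) ≤ 2 ^ (p - 1) := by positivity
    rw [h2]
    nlinarith [mul_le_mul_of_nonneg_left h h3]
  have fin : ∀ (u : Fin n → ℝ) (v : Fin m → ℝ), (∀ i j, u i * v j = u₀ i * v₀ j) →
      (∑ i, u i ^ p = ∑ j, v j ^ p) → ∃ (u : Fin n → ℝ) (v : Fin m → ℝ),
      (∀ i j, u i * v j = u₀ i * v₀ j) ∧
      (∑ i, u i ^ p = ∑ j, v j ^ p) ∧
      (∑ i, u i ^ p ≤ 2 ^ (p - 1) * Real.sqrt S) ∧
      (∑ i, ∑ j, u i ^ p * v j ^ p ≤ 2 ^ p * S) := by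
    intro u v huv hb
    have h4 : ∑ i, ∑ j, u i ^ p * v j ^ p ≤ 2 ^ p * S := by
      simpa only [← mul_pow, huv] using key
    refine ⟨u, v, huv, hb, ?_, h4⟩
    rw [← Finset.sum_mul_sum, ← hb] at h4
    refine le_of_abs_le (abs_le_of_sq_le_sq ?_ (by positivity))
    rw [mul_pow, Real.sq_sqrt hS, sq, ← pow_mul]
    refine h4.trans (mul_le_mul_of_nonneg_right ?_ hS)
    exact pow_le_pow_right₀ (by norm_num) (by omega)
  have hU : 0 ≤ ∑ i, u₀ i ^ p := Finset.sum_nonneg fun i _ => hpe.pow_nonneg _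
  have hV : 0 ≤ ∑ j, v₀ j ^ p := Finset.sum_nonneg fun i _ => hpe.pow_nonneg _
  rcases hU.eq_or_lt with hU0 | hU0
  · have := (Finset.sum_eq_zero_iff_of_nonneg fun i _ => hpe.pow_nonneg (u₀ i)).1 hU0.symm
    refine fin 0 0 (fun i j => ?_) (by simp [hp0])
    simp [pow_eq_zero_iff hp0 |>.1 (this i (Finset.mem_univ i))]
  rcases hV.eq_or_lt with hV0 | hV0
  · have := (Finset.sum_eq_zero_iff_of_nonneg fun i _ => hpe.pow_nonneg (v₀ i)).1 hV0.symm
    refine fin 0 0 (fun i j => ?_) (by simp [hp0])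
    simp [pow_eq_zero_iff hp0 |>.1 (this j (Finset.mem_univ j))]
  set U := ∑ i, u₀ i ^ p
  set V := ∑ j, v₀ j ^ p
  obtain ⟨c, hc, hcp⟩ : ∃ c : ℝ, 0 < c ∧ c ^ p = Real.sqrt (V / U) :=
    ⟨(Real.sqrt (V / U)) ^ ((p : ℝ)⁻¹), by positivity,
      Real.rpow_inv_natCast_pow (by positivity) hp0⟩
  have hd : (c ^ p) ^ 2 * U = V := by
    rw [hcp, Real.sq_sqrt (by positivity)]; field_simp
  refine fin (fun i => c * u₀ i) (fun j => c⁻¹ * v₀ j) (fun i j => by field_simp) ?_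
  simp only [mul_pow, ← Finset.mul_sum]
  change c ^ p * U = c⁻¹ ^ p * V
  rw [← hd, inv_pow]
  field_simp
end

section
/- There is an absolute constant C₀ such that the following holds. Let n, k ≥ 1 and C > 0, let μ be a finitely supported probability measure on (EuclideanSpace ℝ (Fin k))^n with a finite mixture presentation (λ_t, μ'_t)_{t ≤ N}, and for each i, j ∈ Fin n let f_{ij} : EuclideanSpace ℝ (Fin k) × EuclideanSpace ℝ (Fin k) → ℝ be Lipschitz with constant L_{ij} ≥ 0. With truncations x̃_i defined from μ and C, both |∑_t λ_t · (1/n²)·∑_{i,j} 𝔼_{μ'_t}[f_{ij}(x_i, x_j) − f_{ij}(x̃_i, x̃_j)]| and |∑_t λ_t · (1/n²)·∑_{i,j} 𝔼_{(μ'_t)^⊗}[f_{ij}(x_i, x_j) − f_{ij}(x̃_i, x̃_j)]| are at most (C₀/C) · ((1/n)·∑_i 𝔼_μ‖x_i − m_i‖²)^{1/2} · ((1/n²)·∑_{i,j} L_{ij}²)^{1/2}. -/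
open Finset

/-- A finitely supported probability measure on `X`, given by a finite support
and a mass function. -/
structure FinDist (X : Type*) where
  supp : Finset X
  mass : X → ℝ
  nonneg : ∀ x, 0 ≤ mass x
  zero_out : ∀ x ∉ supp, mass x = 0
  total : ∑ x ∈ supp, mass x = 1

/-- Expectation of a real-valued function. -/
noncomputable def FinDist.exp {X : Type*} (μ : FinDist X) (f : X → ℝ) : ℝ :=
  ∑ x ∈ μ.supp, μ.mass x * f x

/-- Expectation of a vector-valued function. -/
noncomputable def FinDist.expVec {X : Type*} {E : Type*} [AddCommGroup E] [Module ℝ E]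
    (μ : FinDist X) (f : X → E) : E :=
  ∑ x ∈ μ.supp, μ.mass x • f x

/-- Expectation of `f` under the product `ν^⊗` of the `n` single-coordinate
marginals of `ν`. -/
noncomputable def prodExp {n : ℕ} {E : Type*} (ν : FinDist (Fin n → E))
    (f : (Fin n → E) → ℝ) : ℝ :=
  ∑ c ∈ Finset.univ.pi (fun _ : Fin n => ν.supp),
    (∏ i : Fin n, ν.mass (c i (Finset.mem_univ i))) * f (fun i => c i (Finset.mem_univ i) i)

/-- The mean `m_i = 𝔼_μ[x_i]`. -/
noncomputable def meanCoord {n k : ℕ} (μ : FinDist (Fin n → EuclideanSpace ℝ (Fin k)))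
    (i : Fin n) : EuclideanSpace ℝ (Fin k) :=
  μ.expVec (fun x => x i)

/-- The truncation `x̃_i`: equals `x_i` if `‖x_i − m_i‖ ≤ C·σ_i`, and `m_i` otherwise. -/
noncomputable def trunc {n k : ℕ} (μ : FinDist (Fin n → EuclideanSpace ℝ (Fin k)))
    (C : ℝ) (i : Fin n) (x : Fin n → EuclideanSpace ℝ (Fin k)) : EuclideanSpace ℝ (Fin k) :=
  if ‖x i - meanCoord μ i‖ ≤ C * Real.sqrt (μ.exp (fun y => ‖y i - meanCoord μ i‖ ^ 2))
  then x i else meanCoord μ i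

lemma FinDist.exp_mono' {X : Type*} (ν : FinDist X) {f g : X → ℝ} (h : ∀ x, f x ≤ g x) :
    ν.exp f ≤ ν.exp g :=
  Finset.sum_le_sum fun x _ => mul_le_mul_of_nonneg_left (h x) (ν.nonneg x)

lemma FinDist.abs_exp_le' {X : Type*} (ν : FinDist X) (f : X → ℝ) :
    |ν.exp f| ≤ ν.exp (fun x => |f x|) := by
  unfold FinDist.exp
  refine (Finset.abs_sum_le_sum_abs _ _).trans (Finset.sum_le_sum fun x _ => ?_)
  rw [abs_mul, abs_of_nonneg (ν.nonneg x)]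

lemma FinDist.exp_lin' {X : Type*} (ν : FinDist X) (l : ℝ) (f g : X → ℝ) :
    ν.exp (fun x => l * (f x + g x)) = l * (ν.exp f + ν.exp g) := by
  unfold FinDist.exp
  rw [← Finset.sum_add_distrib, Finset.mul_sum]
  exact Finset.sum_congr rfl fun x _ => by ring

lemma prodExp_coord' {n : ℕ} {E : Type*} (ν : FinDist (Fin n → E)) (i₀ : Fin n) (g : E → ℝ) :
    prodExp ν (fun x => g (x i₀)) = ν.exp (fun x => g (x i₀)) := by
  classical
  have h := Finset.prod_sum (Finset.univ : Finset (Fin n)) (fun _ => ν.supp)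
    (fun i b => ν.mass b * (if i = i₀ then g (b i) else 1))
  have h1 : ∏ i : Fin n, ∑ b ∈ ν.supp, ν.mass b * (if i = i₀ then g (b i) else 1)
      = ν.exp (fun x => g (x i₀)) := by
    rw [Finset.prod_eq_single i₀]
    · simp [FinDist.exp]
    · intro i _ hi
      simp [hi, ν.total]
    · simp
  rw [h1] at h
  rw [h]
  unfold prodExp
  refine Finset.sum_congr rfl fun c _ => ?_
  rw [Finset.prod_mul_distrib]
  congr 1
  · exact (Finset.prod_attach_univ (fun i => ν.mass (c i.1 i.2))).symm
  · rw [Finset.prod_eq_single ⟨i₀, Finset.mem_univ _⟩]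
    · simp
    · rintro ⟨i, hi⟩ _ hne
      have : i ≠ i₀ := fun h => hne (by subst h; rfl)
      simp [this]
    · simp

lemma prodExp_bound' {n : ℕ} {E : Type*} (ν : FinDist (Fin n → E)) (i j : Fin n) (l : ℝ)
    (F : (Fin n → E) → ℝ) (d e : E → ℝ) (h : ∀ x, |F x| ≤ l * (d (x i) + e (x j))) :
    |prodExp ν F| ≤ l * (ν.exp (fun x => d (x i)) + ν.exp (fun x => e (x j))) := by
  rw [← prodExp_coord' ν i d, ← prodExp_coord' ν j e]
  unfold prodExp
  refine (Finset.abs_sum_le_sum_abs _ _).trans ?_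
  rw [← Finset.sum_add_distrib, Finset.mul_sum]
  refine Finset.sum_le_sum fun c _ => ?_
  have hp : 0 ≤ ∏ i : Fin n, ν.mass (c i (Finset.mem_univ i)) :=
    Finset.prod_nonneg fun i _ => ν.nonneg _
  rw [abs_mul, abs_of_nonneg hp]
  refine (mul_le_mul_of_nonneg_left (h _) hp).trans (le_of_eq ?_)
  ring

/-- the displacement caused by truncation, as a function of one coordinate -/
noncomputable def tdisp {n k : ℕ} (μ : FinDist (Fin n → EuclideanSpace ℝ (Fin k)))
    (C : ℝ) (i : Fin n) (y : EuclideanSpace ℝ (Fin k)) : ℝ :=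
  if ‖y - meanCoord μ i‖ ≤ C * Real.sqrt (μ.exp (fun y => ‖y i - meanCoord μ i‖ ^ 2))
  then 0 else ‖y - meanCoord μ i‖

lemma dist_trunc' {n k : ℕ} (μ : FinDist (Fin n → EuclideanSpace ℝ (Fin k)))
    (C : ℝ) (i : Fin n) (x : Fin n → EuclideanSpace ℝ (Fin k)) :
    dist (x i) (trunc μ C i x) = tdisp μ C i (x i) := by
  unfold trunc tdisp
  split_ifs
  · simp
  · rw [dist_eq_norm]

lemma tdisp_nonneg {n k : ℕ} (μ : FinDist (Fin n → EuclideanSpace ℝ (Fin k)))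
    (C : ℝ) (i : Fin n) (y : EuclideanSpace ℝ (Fin k)) : 0 ≤ tdisp μ C i y := by
  unfold tdisp
  split_ifs
  · exact le_rfl
  · exact norm_nonneg _

lemma exp_tdisp_le {n k : ℕ} (μ : FinDist (Fin n → EuclideanSpace ℝ (Fin k)))
    (C : ℝ) (hC : 0 < C) (i : Fin n) :
    μ.exp (fun x => tdisp μ C i (x i))
      ≤ Real.sqrt (μ.exp (fun y => ‖y i - meanCoord μ i‖ ^ 2)) / C := by
  have hv : 0 ≤ μ.exp (fun y => ‖y i - meanCoord μ i‖ ^ 2) :=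
    Finset.sum_nonneg fun x _ => mul_nonneg (μ.nonneg x) (by positivity)
  rcases hv.eq_or_lt with h0 | hpos
  · rw [← h0]
    have hz := (Finset.sum_eq_zero_iff_of_nonneg
      (fun x _ => mul_nonneg (μ.nonneg x) (by positivity))).1 h0.symm
    simp only [Real.sqrt_zero, zero_div]
    refine le_of_eq (Finset.sum_eq_zero fun x hx => ?_)
    rcases mul_eq_zero.1 (hz x hx) with h | h
    · simp [h]
    · have h' : ‖x i - meanCoord μ i‖ = 0 := by simpa using h
      simp [tdisp, h']
  · have hs := Real.sqrt_pos.2 hpos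
    have hsq := Real.mul_self_sqrt hv
    rw [le_div_iff₀ hC]
    have key : (C * Real.sqrt (μ.exp (fun y => ‖y i - meanCoord μ i‖ ^ 2))) *
        μ.exp (fun x => tdisp μ C i (x i)) ≤ μ.exp (fun y => ‖y i - meanCoord μ i‖ ^ 2) := by
      conv_lhs => rw [FinDist.exp.eq_def μ (fun x => tdisp μ C i (x i)), Finset.mul_sum]
      conv_rhs => rw [FinDist.exp]
      refine Finset.sum_le_sum fun x _ => ?_
      rw [mul_left_comm]
      refine mul_le_mul_of_nonneg_left ?_ (μ.nonneg x)
      unfold tdisp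
      split_ifs with h
      · rw [mul_zero]; positivity
      · rw [sq]
        exact mul_le_mul_of_nonneg_right (not_le.1 h).le (norm_nonneg _)
    refine le_of_mul_le_mul_left ?_ hs
    rw [hsq]
    linarith

lemma lip_bound' {n k : ℕ} (μ : FinDist (Fin n → EuclideanSpace ℝ (Fin k)))
    (C : ℝ) (i j : Fin n)
    (f : EuclideanSpace ℝ (Fin k) × EuclideanSpace ℝ (Fin k) → ℝ) (l : ℝ) (hl : 0 ≤ l)
    (hf : LipschitzWith l.toNNReal f) (x : Fin n → EuclideanSpace ℝ (Fin k)) :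
    |f (x i, x j) - f (trunc μ C i x, trunc μ C j x)|
      ≤ l * (tdisp μ C i (x i) + tdisp μ C j (x j)) := by
  have h := hf.dist_le_mul (x i, x j) (trunc μ C i x, trunc μ C j x)
  rw [Real.dist_eq, Real.coe_toNNReal _ hl, Prod.dist_eq] at h
  simp only [dist_trunc'] at h
  refine h.trans (mul_le_mul_of_nonneg_left ?_ hl)
  exact max_le_add_of_nonneg (tdisp_nonneg _ _ _ _) (tdisp_nonneg _ _ _ _)

lemma cs_bound' {n : ℕ} (hn : 1 ≤ n) (v : Fin n → ℝ) (hv : ∀ i, 0 ≤ v i)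
    (L : Fin n → Fin n → ℝ) :
    (1 / (n : ℝ) ^ 2) * ∑ i, ∑ j, L i j * (√(v i) + √(v j))
      ≤ 2 * √((1 / (n : ℝ)) * ∑ i, v i) * √((1 / (n : ℝ) ^ 2) * ∑ i, ∑ j, L i j ^ 2) := by
  have hn0 : (0 : ℝ) < n := by exact_mod_cast hn
  have hV : 0 ≤ ∑ i, v i := Finset.sum_nonneg fun i _ => hv i
  have hL : 0 ≤ ∑ i, ∑ j, L i j ^ 2 :=
    Finset.sum_nonneg fun i _ => Finset.sum_nonneg fun j _ => sq_nonneg _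
  have hcs := Finset.sum_mul_sq_le_sq_mul_sq (Finset.univ : Finset (Fin n × Fin n))
    (fun p => L p.1 p.2) (fun p => √(v p.1) + √(v p.2))
  simp only [Fintype.sum_prod_type] at hcs
  have h4 : ∑ i, ∑ j, (√(v i) + √(v j)) ^ 2 ≤ 4 * n * ∑ i, v i := by
    calc ∑ i, ∑ j, (√(v i) + √(v j)) ^ 2 ≤ ∑ i, ∑ j, (2 * v i + 2 * v j) := by
          refine Finset.sum_le_sum fun i _ => Finset.sum_le_sum fun j _ => ?_
          nlinarith [Real.sq_sqrt (hv i), Real.sq_sqrt (hv j), sq_nonneg (√(v i) - √(v j))]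
      _ = 4 * n * ∑ i, v i := by
          simp only [Finset.sum_add_distrib, Finset.sum_const, Finset.card_univ,
            Fintype.card_fin, nsmul_eq_mul, ← Finset.mul_sum]
          ring
  refine abs_le_of_sq_le_sq' ?_ (by positivity) |>.2
  rw [mul_pow, mul_pow, mul_pow, Real.sq_sqrt (by positivity), Real.sq_sqrt (by positivity)]
  have h5 := hcs.trans (mul_le_mul_of_nonneg_left h4 hL)
  refine (mul_le_mul_of_nonneg_left h5 (by positivity)).trans (le_of_eq ?_)
  field_simp
  ring

lemma main_bound' {n k : ℕ} (hn : 1 ≤ n) (C : ℝ) (hC : 0 < C) (N : ℕ)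
    (μ : FinDist (Fin n → EuclideanSpace ℝ (Fin k)))
    (lam : Fin N → ℝ) (μ' : Fin N → FinDist (Fin n → EuclideanSpace ℝ (Fin k)))
    (hlam : ∀ t, 0 ≤ lam t)
    (hmix : ∀ f : (Fin n → EuclideanSpace ℝ (Fin k)) → ℝ,
          FinDist.exp μ f = ∑ t, lam t * FinDist.exp (μ' t) f)
    (L : Fin n → Fin n → ℝ) (hL : ∀ i j, 0 ≤ L i j)
    (T : Fin N → Fin n → Fin n → ℝ)
    (hT : ∀ t i j, |T t i j| ≤ L i j * ((μ' t).exp (fun x => tdisp μ C i (x i))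
      + (μ' t).exp (fun x => tdisp μ C j (x j)))) :
    |∑ t, lam t * ((1 / (n : ℝ) ^ 2) * ∑ i, ∑ j, T t i j)|
      ≤ (2 / C) * Real.sqrt ((1 / (n : ℝ)) *
                  ∑ i, FinDist.exp μ (fun x => ‖x i - meanCoord μ i‖ ^ 2))
              * Real.sqrt ((1 / (n : ℝ) ^ 2) * ∑ i, ∑ j, L i j ^ 2) := by
  have hv : ∀ i, 0 ≤ μ.exp (fun y => ‖y i - meanCoord μ i‖ ^ 2) := fun i =>
    Finset.sum_nonneg fun x _ => mul_nonneg (μ.nonneg x) (by positivity)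
  have hcs := cs_bound' hn _ hv L
  have h1 : |∑ t, lam t * ((1 / (n : ℝ) ^ 2) * ∑ i, ∑ j, T t i j)|
      ≤ ∑ t, lam t * ((1 / (n : ℝ) ^ 2) * ∑ i, ∑ j, L i j *
        ((μ' t).exp (fun x => tdisp μ C i (x i)) + (μ' t).exp (fun x => tdisp μ C j (x j)))) := by
    refine (Finset.abs_sum_le_sum_abs _ _).trans (Finset.sum_le_sum fun t _ => ?_)
    rw [abs_mul, abs_of_nonneg (hlam t), abs_mul,
      abs_of_nonneg (by positivity : 0 ≤ 1 / (n : ℝ) ^ 2)]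
    refine mul_le_mul_of_nonneg_left (mul_le_mul_of_nonneg_left ?_ (by positivity)) (hlam t)
    refine (Finset.abs_sum_le_sum_abs _ _).trans (Finset.sum_le_sum fun i _ => ?_)
    exact (Finset.abs_sum_le_sum_abs _ _).trans (Finset.sum_le_sum fun j _ => hT t i j)
  have h2 : ∑ t, lam t * ((1 / (n : ℝ) ^ 2) * ∑ i, ∑ j, L i j *
        ((μ' t).exp (fun x => tdisp μ C i (x i)) + (μ' t).exp (fun x => tdisp μ C j (x j))))
      = (1 / (n : ℝ) ^ 2) * ∑ i, ∑ j, L i j *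
        (μ.exp (fun x => tdisp μ C i (x i)) + μ.exp (fun x => tdisp μ C j (x j))) := by
    simp only [hmix (fun x => tdisp μ C _ (x _)), ← Finset.sum_add_distrib, Finset.mul_sum]
    rw [Finset.sum_comm]
    refine Finset.sum_congr rfl fun i _ => ?_
    rw [Finset.sum_comm]
    refine Finset.sum_congr rfl fun j _ => Finset.sum_congr rfl fun t _ => ?_
    ring
  have h3 : (1 / (n : ℝ) ^ 2) * ∑ i, ∑ j, L i j *
        (μ.exp (fun x => tdisp μ C i (x i)) + μ.exp (fun x => tdisp μ C j (x j)))
      ≤ (1 / C) * ((1 / (n : ℝ) ^ 2) * ∑ i, ∑ j, L i j *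
        (√(μ.exp (fun y => ‖y i - meanCoord μ i‖ ^ 2))
          + √(μ.exp (fun y => ‖y j - meanCoord μ j‖ ^ 2)))) := by
    rw [mul_left_comm]
    refine mul_le_mul_of_nonneg_left ?_ (by positivity)
    rw [Finset.mul_sum]
    refine Finset.sum_le_sum fun i _ => ?_
    rw [Finset.mul_sum]
    refine Finset.sum_le_sum fun j _ => ?_
    rw [mul_left_comm]
    refine mul_le_mul_of_nonneg_left ?_ (hL i j)
    refine (add_le_add (exp_tdisp_le μ C hC i) (exp_tdisp_le μ C hC j)).trans (le_of_eq ?_)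
    ring
  refine (h1.trans (h2.le.trans h3)).trans
    ((mul_le_mul_of_nonneg_left hcs (by positivity)).trans (le_of_eq ?_))
  ring

/-- truncated variables can be rounded — replacing `x_i` by the
truncations `x̃_i` incurs `O(1/C)` error, both under the mixture components and
under their product-of-marginals. -/
theorem stmt_11 :
    ∃ C₀ : ℝ,
      ∀ (n k : ℕ), 1 ≤ n → 1 ≤ k →
      ∀ (C : ℝ), 0 < C →
      ∀ (N : ℕ) (μ : FinDist (Fin n → EuclideanSpace ℝ (Fin k)))
        (lam : Fin N → ℝ) (μ' : Fin N → FinDist (Fin n → EuclideanSpace ℝ (Fin k))),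
        (∀ t, 0 ≤ lam t) → (∑ t, lam t = 1) →
        (∀ f : (Fin n → EuclideanSpace ℝ (Fin k)) → ℝ,
          FinDist.exp μ f = ∑ t, lam t * FinDist.exp (μ' t) f) →
      ∀ (f : Fin n → Fin n → EuclideanSpace ℝ (Fin k) × EuclideanSpace ℝ (Fin k) → ℝ)
        (L : Fin n → Fin n → ℝ),
        (∀ i j, 0 ≤ L i j) →
        (∀ i j, LipschitzWith (L i j).toNNReal (f i j)) →
        |∑ t, lam t * ((1 / (n : ℝ) ^ 2) * ∑ i, ∑ j,
            FinDist.exp (μ' t)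
              (fun x => f i j (x i, x j) - f i j (trunc μ C i x, trunc μ C j x)))|
          ≤ (C₀ / C)
              * Real.sqrt ((1 / (n : ℝ)) *
                  ∑ i, FinDist.exp μ (fun x => ‖x i - meanCoord μ i‖ ^ 2))
              * Real.sqrt ((1 / (n : ℝ) ^ 2) * ∑ i, ∑ j, L i j ^ 2) ∧
        |∑ t, lam t * ((1 / (n : ℝ) ^ 2) * ∑ i, ∑ j,
            prodExp (μ' t)
              (fun x => f i j (x i, x j) - f i j (trunc μ C i x, trunc μ C j x)))|
          ≤ (C₀ / C)
              * Real.sqrt ((1 / (n : ℝ)) *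
                  ∑ i, FinDist.exp μ (fun x => ‖x i - meanCoord μ i‖ ^ 2))
              * Real.sqrt ((1 / (n : ℝ) ^ 2) * ∑ i, ∑ j, L i j ^ 2) := by
  refine ⟨2, ?_⟩
  intro n k hn _ C hC N μ lam μ' hlam _ hmix f L hL hf
  constructor
  · refine main_bound' hn C hC N μ lam μ' hlam hmix L hL _ fun t i j => ?_
    rw [← FinDist.exp_lin']
    exact (FinDist.abs_exp_le' _ _).trans
      (FinDist.exp_mono' _ fun x => lip_bound' μ C i j (f i j) _ (hL i j) (hf i j) x)
  · refine main_bound' hn C hC N μ lam μ' hlam hmix L hL _ fun t i j => ?_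
    exact prodExp_bound' _ i j _ _ (tdisp μ C i) (tdisp μ C j)
      fun x => lip_bound' μ C i j (f i j) _ (hL i j) (hf i j) x
end

section
/- There is an absolute constant C₀ such that the following holds. Let n, k ≥ 1, C > 0, 0 < ε ≤ 1, let μ be a finitely supported probability measure on (EuclideanSpace ℝ (Fin k))^n with a finite mixture presentation (λ_t, μ'_t)_{t ≤ N}, let f_{ij} : EuclideanSpace ℝ (Fin k) × EuclideanSpace ℝ (Fin k) → ℝ be L_{ij}-Lipschitz for each i, j ∈ Fin n, and define truncations x̃_i from μ and C. Assume ∑_t λ_t · (1/n)·∑_i [((1/n)·∑_j L_{ij}²) · ((1/n)·∑_j TV(law_{μ'_t}(x̃_i, x̃_j), law_{μ'_t}(x̃_i) ⊗ law_{μ'_t}(x̃_j))²)] ≤ ε · (1/n²)·∑_{i,j} L_{ij}². Then |∑_t λ_t · (1/n²)·∑_{i,j} (𝔼_{μ'_t} f_{ij}(x_i, x_j) − 𝔼_{(μ'_t)^⊗} f_{ij}(x_i, x_j))| ≤ C₀·(1/C + C·√ε) · ((1/n)·∑_i 𝔼_μ‖x_i − m_i‖²)^{1/2} · ((1/n²)·∑_{i,j}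 L_{ij}²)^{1/2}. -/
open Finset
open scoped Classical

/-- Total variation distance between the joint law of `(g, h)` under `ν` and
the product of the laws of `g` and `h` under `ν`:
`TV(law_ν(g,h), law_ν(g) ⊗ law_ν(h)) = (1/2)·∑_ω |α(ω) − β(ω)|`. -/
noncomputable def tvJoint {X : Type*} {E : Type*} (ν : FinDist X) (g h : X → E) : ℝ :=
  (1 / 2) * ∑ ab ∈ (ν.supp.image g) ×ˢ (ν.supp.image h),
    |(∑ x ∈ ν.supp.filter (fun x => g x = ab.1 ∧ h x = ab.2), ν.mass x)
      - (∑ x ∈ ν.supp.filter (fun x => g x = ab.1), ν.mass x)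
        * (∑ x ∈ ν.supp.filter (fun x => h x = ab.2), ν.mass x)|

section Helpers

lemma prodExp_two {n : ℕ} {E : Type*} (ν : FinDist (Fin n → E)) (i j : Fin n) (hij : i ≠ j)
    (F : E → E → ℝ) :
    prodExp ν (fun x => F (x i) (x j))
      = ∑ x ∈ ν.supp, ∑ y ∈ ν.supp, ν.mass x * ν.mass y * F (x i) (y j) := by
  unfold prodExp
  rw [Finset.sum_univ_pi (fun _ : Fin n => ν.supp)
    (fun c => (∏ l : Fin n, ν.mass (c l (Finset.mem_univ l))) *
      F (c i (Finset.mem_univ i) i) (c j (Finset.mem_univ j) j))]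
  have key : ∀ a ∈ ν.supp, ∀ b ∈ ν.supp,
      ∑ c ∈ Fintype.piFinset (fun _ : Fin n => ν.supp),
        (if c i = a ∧ c j = b then (∏ l : Fin n, ν.mass (c l)) else 0) = ν.mass a * ν.mass b := by
    intro a ha b hb
    have h := Finset.prod_univ_sum (fun _ : Fin n => ν.supp)
      (fun l x => ν.mass x * (if (l = i → x = a) ∧ (l = j → x = b) then 1 else 0))
    have h1 : ∀ c ∈ Fintype.piFinset (fun _ : Fin n => ν.supp),
        (if c i = a ∧ c j = b then (∏ l : Fin n, ν.mass (c l)) else 0)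
        = ∏ l, ν.mass (c l) * (if (l = i → c l = a) ∧ (l = j → c l = b) then 1 else 0) := by
      intro c _
      rw [Finset.prod_mul_distrib]
      split_ifs with hc
      · rw [Finset.prod_eq_one (f := fun l => if (l = i → c l = a) ∧ (l = j → c l = b) then (1:ℝ) else 0), mul_one]
        intro l _
        rw [if_pos]
        exact ⟨fun e => e ▸ hc.1, fun e => e ▸ hc.2⟩
      · symm
        apply mul_eq_zero_of_right
        by_cases hi : c i = a
        · have hj : c j ≠ b := fun h => hc ⟨hi, h⟩
          apply Finset.prod_eq_zero (Finset.mem_univ j)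
          rw [if_neg]
          exact fun h => hj (h.2 rfl)
        · apply Finset.prod_eq_zero (Finset.mem_univ i)
          rw [if_neg]
          exact fun h => hi (h.1 rfl)
    rw [Finset.sum_congr rfl h1, ← h]
    rw [Finset.prod_eq_mul i j hij]
    · simp [hij, hij.symm, ha, hb]
    · intro l _ hl
      simp [hl.1, hl.2, ν.total]
    · simp
    · simp
  symm
  calc ∑ x ∈ ν.supp, ∑ y ∈ ν.supp, ν.mass x * ν.mass y * F (x i) (y j)
      = ∑ x ∈ ν.supp, ∑ y ∈ ν.supp, ∑ c ∈ Fintype.piFinset (fun _ : Fin n => ν.supp),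
        (if c i = x ∧ c j = y then (∏ l : Fin n, ν.mass (c l)) else 0) * F (x i) (y j) := by
        refine Finset.sum_congr rfl fun x hx => Finset.sum_congr rfl fun y hy => ?_
        rw [← key x hx y hy, Finset.sum_mul]
    _ = ∑ c ∈ Fintype.piFinset (fun _ : Fin n => ν.supp), ∑ x ∈ ν.supp, ∑ y ∈ ν.supp,
        (if c i = x ∧ c j = y then (∏ l : Fin n, ν.mass (c l)) else 0) * F (x i) (y j) := by
        rw [Finset.sum_comm (s := Fintype.piFinset (fun _ : Fin n => ν.supp))]
        refine Finset.sum_congr rfl fun x _ => ?_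
        exact Finset.sum_comm
    _ = _ := by
        refine Finset.sum_congr rfl fun c hc => ?_
        rw [Fintype.mem_piFinset] at hc
        rw [Finset.sum_eq_single (c i), Finset.sum_eq_single (c j)]
        · simp
        · intro b _ hb
          simp [hb.symm]
        · intro h; exact absurd (hc j) h
        · intro b _ hb
          simp [hb.symm]
        · intro h; exact absurd (hc i) h

lemma prodExp_one {n : ℕ} {E : Type*} (ν : FinDist (Fin n → E)) (i : Fin n)
    (F : E → ℝ) :
    prodExp ν (fun x => F (x i)) = ν.exp (fun x => F (x i)) := by
  unfold prodExp FinDist.exp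
  rw [Finset.sum_univ_pi (fun _ : Fin n => ν.supp)
    (fun c => (∏ l : Fin n, ν.mass (c l (Finset.mem_univ l))) * F (c i (Finset.mem_univ i) i))]
  have h := Finset.prod_univ_sum (fun _ : Fin n => ν.supp)
      (fun l x => ν.mass x * (if l = i then F (x i) else 1))
  rw [Finset.prod_eq_single i] at h
  · simp only [if_true] at h
    rw [h]
    refine Finset.sum_congr rfl fun c _ => ?_
    rw [Finset.prod_mul_distrib]
    simp
  · intro l _ hl
    simp [hl, ν.total]
  · simp

lemma tv_bound {X E : Type*} (ν : FinDist X) (g h : X → E) (G : E → E → ℝ) (B : ℝ)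
    (hB : ∀ x y, |G (g x) (h y)| ≤ B) :
    |∑ x ∈ ν.supp, ν.mass x * G (g x) (h x)
      - ∑ x ∈ ν.supp, ∑ y ∈ ν.supp, ν.mass x * ν.mass y * G (g x) (h y)|
      ≤ 2 * B * tvJoint ν g h := by
  have e1 : ∑ x ∈ ν.supp, ν.mass x * G (g x) (h x)
      = ∑ ab ∈ (ν.supp.image g) ×ˢ (ν.supp.image h),
        (∑ x ∈ ν.supp.filter (fun x => g x = ab.1 ∧ h x = ab.2), ν.mass x) * G ab.1 ab.2 := by
    rw [← Finset.sum_fiberwise_of_maps_to (s := ν.supp) (g := fun x => (g x, h x))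
      (t := (ν.supp.image g) ×ˢ (ν.supp.image h))]
    · refine Finset.sum_congr rfl fun ab _ => ?_
      rw [Finset.sum_mul]
      refine Finset.sum_congr (by ext x; simp [Prod.ext_iff]) fun x hx => ?_
      rw [Finset.mem_filter] at hx
      rw [hx.2.1, hx.2.2]
    · intro x hx
      exact Finset.mem_product.2 ⟨Finset.mem_image_of_mem _ hx, Finset.mem_image_of_mem _ hx⟩
  have e2 : ∑ x ∈ ν.supp, ∑ y ∈ ν.supp, ν.mass x * ν.mass y * G (g x) (h y)
      = ∑ ab ∈ (ν.supp.image g) ×ˢ (ν.supp.image h),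
        ((∑ x ∈ ν.supp.filter (fun x => g x = ab.1), ν.mass x)
        * (∑ x ∈ ν.supp.filter (fun x => h x = ab.2), ν.mass x)) * G ab.1 ab.2 := by
    rw [Finset.sum_product]
    rw [← Finset.sum_fiberwise_of_maps_to (s := ν.supp) (g := g) (t := ν.supp.image g)
      (fun x hx => Finset.mem_image_of_mem _ hx)]
    refine Finset.sum_congr rfl fun a _ => ?_
    have inner : ∀ x ∈ ν.supp.filter (fun x => g x = a),
        ∑ y ∈ ν.supp, ν.mass x * ν.mass y * G (g x) (h y)
        = ∑ b ∈ ν.supp.image h, ν.mass x *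
          (∑ x ∈ ν.supp.filter (fun x => h x = b), ν.mass x) * G a b := by
     intro x hx
     rw [← Finset.sum_fiberwise_of_maps_to (s := ν.supp) (g := h) (t := ν.supp.image h)
      (fun x hx => Finset.mem_image_of_mem _ hx)]
     refine Finset.sum_congr rfl fun b _ => ?_
     rw [Finset.mul_sum, Finset.sum_mul]
     refine Finset.sum_congr rfl fun y hy => ?_
     rw [Finset.mem_filter] at hx hy
     rw [hx.2, hy.2]
    rw [Finset.sum_congr rfl inner, Finset.sum_comm]
    refine Finset.sum_congr rfl fun b _ => ?_
    rw [← Finset.sum_mul, ← Finset.sum_mul]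
  rw [e1, e2, ← Finset.sum_sub_distrib]
  unfold tvJoint
  refine (Finset.abs_sum_le_sum_abs _ _).trans ?_
  rw [show ∀ S : ℝ, 2 * B * (1 / 2 * S) = B * S by intro S; ring, Finset.mul_sum]
  refine Finset.sum_le_sum fun ab hab => ?_
  rw [← sub_mul, abs_mul, mul_comm]
  refine mul_le_mul_of_nonneg_right ?_ (abs_nonneg _)
  rw [Finset.mem_product, Finset.mem_image, Finset.mem_image] at hab
  obtain ⟨⟨x, _, hx⟩, ⟨y, _, hy⟩⟩ := hab
  rw [← hx, ← hy]
  exact hB x y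

/-- The pairwise estimate. `p i` is the centre, `τ i` depends only on the `i`th coordinate. -/
lemma pair_bound {n : ℕ} {E : Type*} [NormedAddCommGroup E] (ν : FinDist (Fin n → E))
    (i j : Fin n) (τ : Fin n → E → E) (p : E) (R : ℝ) (hR : 0 ≤ R) (hτ : ∀ v, ‖τ i v - p‖ ≤ R)
    (f : E × E → ℝ) (L : ℝ) (hL : 0 ≤ L) (hf : LipschitzWith L.toNNReal f) :
    |ν.exp (fun x => f (x i, x j)) - prodExp ν (fun x => f (x i, x j))|
      ≤ 2 * L * (ν.exp (fun x => ‖x i - τ i (x i)‖) + ν.exp (fun x => ‖x j - τ j (x j)‖))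
        + 2 * (L * R) * tvJoint ν (fun x => τ i (x i)) (fun x => τ j (x j)) := by
  have ha : ∀ l, 0 ≤ ν.exp (fun x => ‖x l - τ l (x l)‖) := fun l =>
    Finset.sum_nonneg fun x _ => mul_nonneg (ν.nonneg x) (norm_nonneg _)
  have htv : 0 ≤ tvJoint ν (fun x => τ i (x i)) (fun x => τ j (x j)) :=
    mul_nonneg (by norm_num) (Finset.sum_nonneg fun _ _ => abs_nonneg _)
  by_cases hij : i = j
  · subst hij
    rw [prodExp_one ν i (fun v => f (v, v)), sub_self, abs_zero]
    have := ha i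
    positivity
  have hlip : ∀ u v u' v', |f (u, v) - f (u', v')| ≤ L * (‖u - u'‖ + ‖v - v'‖) := by
    intro u v u' v'
    have h := hf.dist_le_mul (u, v) (u', v')
    rw [Real.dist_eq, Real.coe_toNNReal _ hL, Prod.dist_eq, dist_eq_norm, dist_eq_norm] at h
    refine h.trans (mul_le_mul_of_nonneg_left ?_ hL)
    exact max_le (le_add_of_nonneg_right (norm_nonneg _)) (le_add_of_nonneg_left (norm_nonneg _))
  rw [prodExp_two ν i j hij (fun u v => f (u, v))]
  set ai := ν.exp (fun x => ‖x i - τ i (x i)‖) with hai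
  set aj := ν.exp (fun x => ‖x j - τ j (x j)‖) with haj
  set TV := tvJoint ν (fun x => τ i (x i)) (fun x => τ j (x j)) with hTV
  have b1 : |ν.exp (fun x => f (x i, x j)) - ∑ x ∈ ν.supp, ν.mass x * f (τ i (x i), τ j (x j))|
      ≤ L * (ai + aj) := by
    unfold FinDist.exp at hai haj ⊢
    rw [← Finset.sum_sub_distrib, hai, haj, ← Finset.sum_add_distrib, Finset.mul_sum]
    refine (Finset.abs_sum_le_sum_abs _ _).trans (Finset.sum_le_sum fun x _ => ?_)
    rw [← mul_sub, abs_mul, abs_of_nonneg (ν.nonneg x)]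
    have := mul_le_mul_of_nonneg_left (hlip (x i) (x j) (τ i (x i)) (τ j (x j))) (ν.nonneg x)
    linarith
  have b2 : |∑ x ∈ ν.supp, ∑ y ∈ ν.supp, ν.mass x * ν.mass y * f (x i, y j)
      - ∑ x ∈ ν.supp, ∑ y ∈ ν.supp, ν.mass x * ν.mass y * f (τ i (x i), τ j (y j))|
      ≤ L * (ai + aj) := by
    have e : ai + aj = ∑ x ∈ ν.supp, ∑ y ∈ ν.supp, ν.mass x * ν.mass y *
        (‖x i - τ i (x i)‖ + ‖y j - τ j (y j)‖) := by
      simp_rw [mul_add, Finset.sum_add_distrib]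
      congr 1
      · rw [hai]; unfold FinDist.exp
        refine Finset.sum_congr rfl fun x _ => ?_
        rw [← Finset.sum_mul, ← Finset.mul_sum, ν.total, mul_one]
      · rw [haj, Finset.sum_comm]; unfold FinDist.exp
        refine Finset.sum_congr rfl fun x _ => ?_
        rw [← Finset.sum_mul, ← Finset.sum_mul, ν.total, one_mul]
    rw [e, ← Finset.sum_sub_distrib, Finset.mul_sum]
    refine (Finset.abs_sum_le_sum_abs _ _).trans (Finset.sum_le_sum fun x _ => ?_)
    rw [← Finset.sum_sub_distrib, Finset.mul_sum]
    refine (Finset.abs_sum_le_sum_abs _ _).trans (Finset.sum_le_sum fun y _ => ?_)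
    have hm := mul_nonneg (ν.nonneg x) (ν.nonneg y)
    rw [← mul_sub, abs_mul, abs_of_nonneg hm]
    have := mul_le_mul_of_nonneg_left (hlip (x i) (y j) (τ i (x i)) (τ j (y j))) hm
    linarith
  have b3 : |∑ x ∈ ν.supp, ν.mass x * f (τ i (x i), τ j (x j))
      - ∑ x ∈ ν.supp, ∑ y ∈ ν.supp, ν.mass x * ν.mass y * f (τ i (x i), τ j (y j))|
      ≤ 2 * (L * R) * TV := by
    have h := tv_bound ν (fun x => τ i (x i)) (fun x => τ j (x j))
      (fun u v => f (u, v) - f (p, v)) (L * R) (by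
        intro x y
        refine (hlip _ _ _ _).trans (mul_le_mul_of_nonneg_left ?_ hL)
        simpa using hτ (x i))
    refine le_trans (le_of_eq ?_) h
    congr 1
    simp_rw [mul_sub, Finset.sum_sub_distrib]
    have e : ∑ x ∈ ν.supp, ∑ y ∈ ν.supp, ν.mass x * ν.mass y * f (p, τ j (y j))
        = ∑ x ∈ ν.supp, ν.mass x * f (p, τ j (x j)) := by
      rw [Finset.sum_comm]
      refine Finset.sum_congr rfl fun x _ => ?_
      rw [← Finset.sum_mul, ← Finset.sum_mul, ν.total, one_mul]
    rw [e]; ring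
  rw [abs_le] at *
  constructor <;> linarith [b1.1, b1.2, b2.1, b2.2, b3.1, b3.2]

lemma trunc_err {n : ℕ} {E : Type*} [NormedAddCommGroup E] (μ : FinDist (Fin n → E)) (i : Fin n)
    (m : E) (C : ℝ) (hC : 0 < C) (s : ℝ) (hs : s = Real.sqrt (μ.exp (fun y => ‖y i - m‖ ^ 2))) :
    μ.exp (fun x => ‖x i - (if ‖x i - m‖ ≤ C * s then x i else m)‖) ≤ s / C := by
  have hnn : 0 ≤ μ.exp (fun y => ‖y i - m‖ ^ 2) :=
    Finset.sum_nonneg fun x _ => mul_nonneg (μ.nonneg x) (by positivity)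
  have hs0 : 0 ≤ s := hs ▸ Real.sqrt_nonneg _
  have hsq : s ^ 2 = μ.exp (fun y => ‖y i - m‖ ^ 2) := by rw [hs, Real.sq_sqrt hnn]
  rcases hs0.eq_or_lt with h0 | hpos
  · have hz : μ.exp (fun y => ‖y i - m‖ ^ 2) = 0 := by rw [← hsq, ← h0]; norm_num
    unfold FinDist.exp at hz ⊢
    rw [Finset.sum_eq_zero_iff_of_nonneg
      (fun x _ => mul_nonneg (μ.nonneg x) (by positivity))] at hz
    rw [← h0, zero_div]
    apply le_of_eq
    apply Finset.sum_eq_zero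
    intro x hx
    rcases mul_eq_zero.1 (hz x hx) with h | h
    · rw [h, zero_mul]
    · have : ‖x i - m‖ = 0 := by simpa using h
      simp [this]
  · rw [le_div_iff₀ hC]
    refine le_of_mul_le_mul_right ?_ hpos
    rw [← sq, hsq]
    unfold FinDist.exp
    rw [Finset.sum_mul, Finset.sum_mul]
    refine Finset.sum_le_sum fun x _ => ?_
    have : ‖x i - (if ‖x i - m‖ ≤ C * s then x i else m)‖ * (C * s) ≤ ‖x i - m‖ ^ 2 := by
      split_ifs with h
      · simp
      · push Not at h
        nlinarith [norm_nonneg (x i - m)]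
    have := mul_le_mul_of_nonneg_left this (μ.nonneg x)
    linarith

lemma final_sum {n N : ℕ} (hn : 1 ≤ n) (C ε : ℝ) (hC : 0 < C) (hε : 0 < ε)
    (lam : Fin N → ℝ) (hl : ∀ t, 0 ≤ lam t) (hl1 : ∑ t, lam t = 1)
    (L : Fin n → Fin n → ℝ) (hL : ∀ i j, 0 ≤ L i j) (s : Fin n → ℝ) (hs : ∀ i, 0 ≤ s i)
    (T : Fin N → Fin n → Fin n → ℝ) (D : Fin N → Fin n → Fin n → ℝ) (a : Fin N → Fin n → ℝ)
    (ha : ∀ i, ∑ t, lam t * a t i ≤ s i / C)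
    (hD : ∀ t i j, |D t i j| ≤ 2 * L i j * (a t i + a t j) + 2 * (L i j * (C * s i)) * T t i j)
    (hT : ∑ t, lam t * ((1 / (n : ℝ)) * ∑ i, ((1 / (n : ℝ)) * ∑ j, L i j ^ 2) *
            ((1 / (n : ℝ)) * ∑ j, T t i j ^ 2))
          ≤ ε * ((1 / (n : ℝ) ^ 2) * ∑ i, ∑ j, L i j ^ 2)) :
    |∑ t, lam t * ((1 / (n : ℝ) ^ 2) * ∑ i, ∑ j, D t i j)|
      ≤ 4 * (1 / C + C * Real.sqrt ε) * Real.sqrt ((1 / (n : ℝ)) * ∑ i, s i ^ 2)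
        * Real.sqrt ((1 / (n : ℝ) ^ 2) * ∑ i, ∑ j, L i j ^ 2) := by
  have hn0 : (0 : ℝ) < n := by exact_mod_cast hn
  set r : ℝ := 1 / (n : ℝ) with hr
  have hr0 : 0 < r := by positivity
  have hrn : r * n = 1 := by rw [hr]; field_simp
  have hr2 : 1 / (n : ℝ) ^ 2 = r ^ 2 := by rw [hr]; field_simp
  rw [hr2] at hT ⊢
  set P := r * ∑ i, s i ^ 2 with hP
  set Q := r ^ 2 * ∑ i, ∑ j, L i j ^ 2 with hQ
  have hP0 : 0 ≤ P := mul_nonneg hr0.le (Finset.sum_nonneg fun _ _ => sq_nonneg _)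
  have hQ0 : 0 ≤ Q := mul_nonneg (by positivity)
    (Finset.sum_nonneg fun _ _ => Finset.sum_nonneg fun _ _ => sq_nonneg _)
  -- first Cauchy-Schwarz
  have cs1 : ∀ u : Fin n → Fin n → ℝ, (r ^ 2 * ∑ i, ∑ j, u i j ^ 2 = P) →
      r ^ 2 * ∑ i, ∑ j, L i j * u i j ≤ Real.sqrt P * Real.sqrt Q := by
    intro u hu
    rw [← Real.sqrt_mul hP0]
    apply Real.le_sqrt_of_sq_le
    have h := Finset.sum_mul_sq_le_sq_mul_sq (Finset.univ : Finset (Fin n × Fin n))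
      (fun q => L q.1 q.2) (fun q => u q.1 q.2)
    simp only [Fintype.sum_prod_type] at h
    rw [← hu, hQ]
    have := mul_le_mul_of_nonneg_left h (by positivity : 0 ≤ r ^ 4)
    nlinarith
  have A1 : r ^ 2 * ∑ i, ∑ j, L i j * s i ≤ Real.sqrt P * Real.sqrt Q := by
    apply cs1 (fun i _ => s i)
    simp only [Finset.sum_const, Finset.card_univ, Fintype.card_fin, nsmul_eq_mul]
    rw [← Finset.mul_sum, hP]
    linear_combination (r * ∑ i, s i ^ 2) * hrn
  have A2 : r ^ 2 * ∑ i, ∑ j, L i j * s j ≤ Real.sqrt P * Real.sqrt Q := by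
    apply cs1 (fun _ j => s j)
    simp only [Finset.sum_const, Finset.card_univ, Fintype.card_fin, nsmul_eq_mul]
    rw [hP]
    linear_combination (r * ∑ i, s i ^ 2) * hrn
  -- second Cauchy-Schwarz
  have A3 : r ^ 2 * ∑ t, ∑ i, lam t * (s i * ∑ j, L i j * T t i j)
      ≤ Real.sqrt ε * (Real.sqrt P * Real.sqrt Q) := by
    rw [← Real.sqrt_mul hP0, ← Real.sqrt_mul hε.le]
    apply Real.le_sqrt_of_sq_le
    have h := Finset.sum_sq_le_sum_mul_sum_of_sq_le_mul (Finset.univ : Finset (Fin N × Fin n))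
      (r := fun q => lam q.1 * (s q.2 * ∑ j, L q.2 j * T q.1 q.2 j))
      (f := fun q => lam q.1 * s q.2 ^ 2)
      (g := fun q => lam q.1 * (∑ j, L q.2 j * T q.1 q.2 j) ^ 2)
      (fun q _ => mul_nonneg (hl _) (sq_nonneg _)) (fun q _ => mul_nonneg (hl _) (sq_nonneg _))
      (fun q _ => le_of_eq (by ring))
    simp only [Fintype.sum_prod_type] at h
    have e1 : ∑ t, ∑ i, lam t * s i ^ 2 = ∑ i, s i ^ 2 := by
      simp_rw [← Finset.mul_sum]
      rw [← Finset.sum_mul, hl1, one_mul]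
    rw [e1] at h
    have h2 : r ^ 3 * ∑ t, ∑ i, lam t * (∑ j, L i j * T t i j) ^ 2 ≤ ε * Q := by
      refine le_trans ?_ hT
      rw [Finset.mul_sum]
      refine Finset.sum_le_sum fun t _ => ?_
      rw [← Finset.mul_sum, mul_left_comm]
      refine mul_le_mul_of_nonneg_left ?_ (hl t)
      rw [Finset.mul_sum, Finset.mul_sum]
      refine Finset.sum_le_sum fun i _ => ?_
      have := Finset.sum_mul_sq_le_sq_mul_sq Finset.univ (fun j => L i j) (fun j => T t i j)
      have := mul_le_mul_of_nonneg_left this (by positivity : 0 ≤ r ^ 3)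
      nlinarith
    have h3 := mul_le_mul_of_nonneg_left h2 hP0
    have h4 := mul_le_mul_of_nonneg_left h (by positivity : 0 ≤ r ^ 4)
    rw [hP] at h3 ⊢
    nlinarith
  -- main bound
  have M : |∑ t, lam t * (r ^ 2 * ∑ i, ∑ j, D t i j)|
      ≤ ∑ t, lam t * (r ^ 2 * ∑ i, ∑ j, (2 * L i j * (a t i + a t j) + 2 * (L i j * (C * s i)) * T t i j)) := by
    refine (Finset.abs_sum_le_sum_abs _ _).trans (Finset.sum_le_sum fun t _ => ?_)
    rw [abs_mul, abs_of_nonneg (hl t), abs_mul, abs_of_nonneg (by positivity : 0 ≤ r ^ 2)]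
    refine mul_le_mul_of_nonneg_left (mul_le_mul_of_nonneg_left ?_ (by positivity)) (hl t)
    refine (Finset.abs_sum_le_sum_abs _ _).trans (Finset.sum_le_sum fun i _ => ?_)
    refine (Finset.abs_sum_le_sum_abs _ _).trans (Finset.sum_le_sum fun j _ => ?_)
    exact hD t i j
  have M2 : ∑ t, lam t * (r ^ 2 * ∑ i, ∑ j, (2 * L i j * (a t i + a t j) + 2 * (L i j * (C * s i)) * T t i j))
      = 2 * (r ^ 2 * ∑ i, ∑ j, L i j * (∑ t, lam t * a t i + ∑ t, lam t * a t j))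
        + 2 * C * (r ^ 2 * ∑ t, ∑ i, lam t * (s i * ∑ j, L i j * T t i j)) := by
    have e : ∑ i, ∑ j, L i j * (∑ t, lam t * a t i + ∑ t, lam t * a t j)
        = ∑ t, ∑ i, ∑ j, lam t * (L i j * (a t i + a t j)) := by
      rw [Finset.sum_comm]
      rw [Finset.sum_comm (s := (Finset.univ : Finset (Fin N)))]
      rw [Finset.sum_comm]
      refine Finset.sum_congr rfl fun i _ => ?_
      rw [Finset.sum_comm (s := (Finset.univ : Finset (Fin N)))]
      refine Finset.sum_congr rfl fun j _ => ?_
      rw [← Finset.sum_add_distrib, Finset.mul_sum]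
      refine Finset.sum_congr rfl fun t _ => ?_
      ring
    rw [e]
    simp_rw [Finset.mul_sum]
    simp_rw [← Finset.sum_add_distrib]
    refine Finset.sum_congr rfl fun t _ => Finset.sum_congr rfl fun i _ =>
      Finset.sum_congr rfl fun j _ => ?_
    ring
  have M3 : r ^ 2 * ∑ i, ∑ j, L i j * (∑ t, lam t * a t i + ∑ t, lam t * a t j)
      ≤ 1 / C * (2 * (Real.sqrt P * Real.sqrt Q)) := by
    calc r ^ 2 * ∑ i, ∑ j, L i j * (∑ t, lam t * a t i + ∑ t, lam t * a t j)
        ≤ r ^ 2 * ∑ i, ∑ j, L i j * (s i / C + s j / C) := by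
          refine mul_le_mul_of_nonneg_left ?_ (by positivity)
          refine Finset.sum_le_sum fun i _ => Finset.sum_le_sum fun j _ => ?_
          exact mul_le_mul_of_nonneg_left (add_le_add (ha i) (ha j)) (hL i j)
      _ = 1 / C * (r ^ 2 * ∑ i, ∑ j, L i j * s i + r ^ 2 * ∑ i, ∑ j, L i j * s j) := by
          rw [← mul_add, ← Finset.sum_add_distrib]
          simp_rw [← Finset.sum_add_distrib, Finset.mul_sum]
          refine Finset.sum_congr rfl fun i _ => Finset.sum_congr rfl fun j _ => ?_
          ring
      _ ≤ _ := by
          refine mul_le_mul_of_nonneg_left ?_ (by positivity)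
          linarith
  have M4 := mul_le_mul_of_nonneg_left A3 hC.le
  have hpos : 0 ≤ C * (Real.sqrt ε * (Real.sqrt P * Real.sqrt Q)) := by positivity
  rw [M2] at M
  refine M.trans ?_
  linarith

end Helpers

/-- characterizing the Lipschitz rounding error under an
approximate pairwise independence (total variation) assumption on the truncated
variables. -/
theorem stmt_12 :
    ∃ C₀ : ℝ,
      ∀ (n k : ℕ), 1 ≤ n → 1 ≤ k →
      ∀ (C ε : ℝ), 0 < C → 0 < ε → ε ≤ 1 →
      ∀ (N : ℕ) (μ : FinDist (Fin n → EuclideanSpace ℝ (Fin k)))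
        (lam : Fin N → ℝ) (μ' : Fin N → FinDist (Fin n → EuclideanSpace ℝ (Fin k))),
        (∀ t, 0 ≤ lam t) → (∑ t, lam t = 1) →
        (∀ f : (Fin n → EuclideanSpace ℝ (Fin k)) → ℝ,
          FinDist.exp μ f = ∑ t, lam t * FinDist.exp (μ' t) f) →
      ∀ (f : Fin n → Fin n → EuclideanSpace ℝ (Fin k) × EuclideanSpace ℝ (Fin k) → ℝ)
        (L : Fin n → Fin n → ℝ),
        (∀ i j, 0 ≤ L i j) →
        (∀ i j, LipschitzWith (L i j).toNNReal (f i j)) →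
        (∑ t, lam t * ((1 / (n : ℝ)) * ∑ i,
            ((1 / (n : ℝ)) * ∑ j, L i j ^ 2) *
            ((1 / (n : ℝ)) * ∑ j,
              tvJoint (μ' t) (fun x => trunc μ C i x) (fun x => trunc μ C j x) ^ 2))
          ≤ ε * ((1 / (n : ℝ) ^ 2) * ∑ i, ∑ j, L i j ^ 2)) →
        |∑ t, lam t * ((1 / (n : ℝ) ^ 2) * ∑ i, ∑ j,
            (FinDist.exp (μ' t) (fun x => f i j (x i, x j))
              - prodExp (μ' t) (fun x => f i j (x i, x j))))|
          ≤ C₀ * (1 / C + C * Real.sqrt ε)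
              * Real.sqrt ((1 / (n : ℝ)) *
                  ∑ i, FinDist.exp μ (fun x => ‖x i - meanCoord μ i‖ ^ 2))
              * Real.sqrt ((1 / (n : ℝ) ^ 2) * ∑ i, ∑ j, L i j ^ 2) := by
  refine ⟨4, ?_⟩
  intro n k hn hk C ε hC hε _ N μ lam μ' hl hl1 hmix f L hL hf hT
  set m := fun i => meanCoord μ i with hm
  set s : Fin n → ℝ := fun i => Real.sqrt (μ.exp (fun y => ‖y i - meanCoord μ i‖ ^ 2)) with hs
  have hs0 : ∀ i, 0 ≤ s i := fun i => Real.sqrt_nonneg _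
  set τ : Fin n → EuclideanSpace ℝ (Fin k) → EuclideanSpace ℝ (Fin k) :=
    fun i v => if ‖v - meanCoord μ i‖ ≤ C * s i then v else meanCoord μ i with hτ
  have hs2 : ∑ i, FinDist.exp μ (fun x => ‖x i - meanCoord μ i‖ ^ 2) = ∑ i, s i ^ 2 := by
    refine Finset.sum_congr rfl fun i _ => ?_
    rw [hs]
    exact (Real.sq_sqrt (Finset.sum_nonneg fun x _ =>
      mul_nonneg (μ.nonneg x) (by positivity))).symm
  rw [hs2]
  refine final_sum hn C ε hC hε lam hl hl1 L hL s hs0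
    (fun t i j => tvJoint (μ' t) (fun x => trunc μ C i x) (fun x => trunc μ C j x))
    _ (fun t i => (μ' t).exp (fun x => ‖x i - τ i (x i)‖)) ?_ ?_ hT
  · intro i
    rw [← hmix (fun x => ‖x i - τ i (x i)‖)]
    exact trunc_err μ i (meanCoord μ i) C hC (s i) rfl
  · intro t i j
    refine pair_bound (μ' t) i j τ (meanCoord μ i) (C * s i) (mul_nonneg hC.le (hs0 i)) ?_
      (f i j) (L i j) (hL i j) (hf i j)
    intro v
    simp only [hτ]
    split_ifs with h
    · exact h
    · simpa using mul_nonneg hC.le (hs0 i)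
end

section
/- Let n, k ≥ 1, ε > 0, η > 0, let μ be a finitely supported probability measure on (ℝ^k)^n with (1/n)·∑_i tr(Cov_μ(x_i)) ≤ η, and let A : Fin n → Fin n → ℝ with ∑_{i,j}(A i j)² > 0. Suppose (1/n²)·∑_{i,j} |A i j| · |∑_{ℓ=1}^k Cov_μ((x_i)_ℓ, (x_j)_ℓ)| ≥ ε·(1/n²)·∑_{i,j}(A i j)². Then, setting ψ_i = (∑_j (A i j)²)/(∑_{i',j}(A i' j)²), there exists j ∈ Fin n such that ∑_i ψ_i·[tr(Cov_μ(x_i)) − ∑_z ℙ_μ[x_j = z]·tr(Cov_{μ∣(x_j = z)}(x_i))] ≥ (ε²/(η·k))·(1/n²)·∑_{i,j}(A i j)², where the inner sum runs over the finitely many z with ℙ_μ[x_j = z] > 0. -/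
open Finset
open scoped Classical

/-- Covariance of two real-valued random variables. -/
noncomputable def covFD {X : Type*} (μ : FinDist X) (f g : X → ℝ) : ℝ :=
  μ.exp (fun x => (f x - μ.exp f) * (g x - μ.exp g))

/-- The trace of the covariance matrix of the coordinate `x_i ∈ ℝ^k`:
`tr(Cov_μ(x_i)) = ∑_ℓ Var_μ((x_i)_ℓ)`. -/
noncomputable def trCov {n k : ℕ} (μ : FinDist (Fin n → Fin k → ℝ)) (i : Fin n) : ℝ :=
  ∑ ℓ : Fin k, covFD μ (fun x => x i ℓ) (fun x => x i ℓ)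

/-- `ℙ_μ[x_j = z]`. -/
noncomputable def probEq {n k : ℕ} (μ : FinDist (Fin n → Fin k → ℝ))
    (j : Fin n) (z : Fin k → ℝ) : ℝ :=
  ∑ x ∈ μ.supp.filter (fun x => x j = z), μ.mass x

/-- Expectation of `f` under the conditional distribution `μ ∣ (x_j = z)`. -/
noncomputable def condExpFD {n k : ℕ} (μ : FinDist (Fin n → Fin k → ℝ))
    (j : Fin n) (z : Fin k → ℝ) (f : (Fin n → Fin k → ℝ) → ℝ) : ℝ :=
  (∑ x ∈ μ.supp.filter (fun x => x j = z), μ.mass x * f x) / probEq μ j z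

/-- `tr(Cov_{μ∣(x_j = z)}(x_i))`, the trace of the conditional covariance matrix. -/
noncomputable def condTrCov {n k : ℕ} (μ : FinDist (Fin n → Fin k → ℝ))
    (j : Fin n) (z : Fin k → ℝ) (i : Fin n) : ℝ :=
  ∑ ℓ : Fin k, condExpFD μ j z
    (fun x => (x i ℓ - condExpFD μ j z (fun y => y i ℓ)) ^ 2)

/-- Orthogonality of `f - E[f | x_j]` to functions of `x_j`. -/
theorem aux_orth {n k : ℕ} (μ : FinDist (Fin n → Fin k → ℝ)) (j : Fin n)
    (f : (Fin n → Fin k → ℝ) → ℝ) (h : (Fin k → ℝ) → ℝ) :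
    ∑ x ∈ μ.supp, μ.mass x * ((f x - condExpFD μ j (x j) f) * h (x j)) = 0 := by
  rw [← Finset.sum_fiberwise_of_maps_to (s := μ.supp) (t := μ.supp.image (fun x => x j))
    (g := fun x => x j) (fun x hx => Finset.mem_image_of_mem _ hx)]
  refine Finset.sum_eq_zero fun z _ => ?_
  have h1 : ∑ x ∈ μ.supp.filter (fun x => x j = z),
      μ.mass x * ((f x - condExpFD μ j (x j) f) * h (x j))
      = ((∑ x ∈ μ.supp.filter (fun x => x j = z), μ.mass x * f x)
        - probEq μ j z * condExpFD μ j z f) * h z := by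
    unfold probEq
    rw [Finset.sum_mul, ← Finset.sum_sub_distrib, Finset.sum_mul]
    refine Finset.sum_congr rfl fun x hx => ?_
    rw [(Finset.mem_filter.1 hx).2]
    ring
  rw [h1]
  by_cases hp : probEq μ j z = 0
  · have h2 : ∑ x ∈ μ.supp.filter (fun x => x j = z), μ.mass x * f x = 0 := by
      refine Finset.sum_eq_zero fun x hx => ?_
      have := (Finset.sum_eq_zero_iff_of_nonneg (fun x _ => μ.nonneg x)).1 hp x hx
      rw [this, zero_mul]
    rw [h2, hp]; ring
  · have : probEq μ j z * condExpFD μ j z f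
        = ∑ x ∈ μ.supp.filter (fun x => x j = z), μ.mass x * f x := by
      unfold condExpFD; field_simp
    rw [this]; ring

theorem aux_condvar {n k : ℕ} (μ : FinDist (Fin n → Fin k → ℝ)) (j : Fin n)
    (f : (Fin n → Fin k → ℝ) → ℝ) :
    ∑ z ∈ μ.supp.image (fun x => x j),
      probEq μ j z * condExpFD μ j z (fun x => (f x - condExpFD μ j z f) ^ 2)
    = ∑ x ∈ μ.supp, μ.mass x * (f x - condExpFD μ j (x j) f) ^ 2 := by
  rw [← Finset.sum_fiberwise_of_maps_to (s := μ.supp) (t := μ.supp.image (fun x => x j))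
    (g := fun x => x j) (fun x hx => Finset.mem_image_of_mem _ hx)]
  refine Finset.sum_congr rfl fun z _ => ?_
  have h1 : ∑ x ∈ μ.supp.filter (fun x => x j = z),
      μ.mass x * (f x - condExpFD μ j (x j) f) ^ 2
      = ∑ x ∈ μ.supp.filter (fun x => x j = z), μ.mass x * (f x - condExpFD μ j z f) ^ 2 := by
    refine Finset.sum_congr rfl fun x hx => ?_
    rw [(Finset.mem_filter.1 hx).2]
  rw [h1]
  by_cases hp : probEq μ j z = 0
  · rw [hp, zero_mul]
    symm
    refine Finset.sum_eq_zero fun x hx => ?_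
    have := (Finset.sum_eq_zero_iff_of_nonneg (fun x _ => μ.nonneg x)).1 hp x hx
    rw [this, zero_mul]
  · generalize condExpFD μ j z f = c
    unfold condExpFD; field_simp

/-- The decrease of variance is the variance of the conditional expectation. -/
theorem aux_drop {n k : ℕ} (μ : FinDist (Fin n → Fin k → ℝ)) (i j : Fin n) :
    trCov μ i - ∑ z ∈ μ.supp.image (fun x => x j), probEq μ j z * condTrCov μ j z i
    = ∑ ℓ : Fin k, ∑ x ∈ μ.supp, μ.mass x *
      (condExpFD μ j (x j) (fun y => y i ℓ) - μ.exp (fun y => y i ℓ)) ^ 2 := by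
  unfold trCov condTrCov
  simp_rw [Finset.mul_sum]
  rw [Finset.sum_comm, ← Finset.sum_sub_distrib]
  refine Finset.sum_congr rfl fun ℓ _ => ?_
  rw [aux_condvar μ j (fun y => y i ℓ)]
  have h0 := aux_orth μ j (fun y => y i ℓ)
    (fun z => 2 * (condExpFD μ j z (fun y => y i ℓ) - μ.exp (fun y => y i ℓ)))
  unfold covFD
  rw [sub_eq_iff_eq_add, ← sub_eq_zero, ← h0]
  conv_lhs => rw [FinDist.exp]
  rw [← Finset.sum_add_distrib, ← Finset.sum_sub_distrib]
  refine Finset.sum_congr rfl fun x _ => ?_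
  ring

theorem aux_key {n k : ℕ} (μ : FinDist (Fin n → Fin k → ℝ)) (i j : Fin n) :
    (∑ ℓ, covFD μ (fun x => x i ℓ) (fun x => x j ℓ)) ^ 2 ≤
    (trCov μ i - ∑ z ∈ μ.supp.image (fun x => x j), probEq μ j z * condTrCov μ j z i)
      * trCov μ j := by
  have h1 : ∀ ℓ, covFD μ (fun x => x i ℓ) (fun x => x j ℓ) = ∑ x ∈ μ.supp, μ.mass x *
      ((condExpFD μ j (x j) (fun y => y i ℓ) - μ.exp (fun y => y i ℓ)) *
        (x j ℓ - μ.exp (fun y => y j ℓ))) := by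
    intro ℓ
    have h0 := aux_orth μ j (fun y => y i ℓ) (fun z => z ℓ - μ.exp (fun y => y j ℓ))
    unfold covFD
    rw [← sub_eq_zero, ← h0]
    conv_lhs => rw [FinDist.exp]
    rw [← Finset.sum_sub_distrib]
    refine Finset.sum_congr rfl fun x _ => ?_
    ring
  have h2 : trCov μ j = ∑ ℓ, ∑ x ∈ μ.supp, μ.mass x * (x j ℓ - μ.exp (fun y => y j ℓ)) ^ 2 := by
    unfold trCov covFD
    refine Finset.sum_congr rfl fun ℓ _ => ?_
    conv_lhs => rw [FinDist.exp]
    refine Finset.sum_congr rfl fun x _ => ?_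
    ring
  rw [aux_drop, h2]
  simp_rw [h1]
  rw [← Finset.sum_product', ← Finset.sum_product', ← Finset.sum_product']
  refine Finset.sum_sq_le_sum_mul_sum_of_sq_le_mul _ ?_ ?_ ?_
  · intro p _; exact mul_nonneg (μ.nonneg _) (sq_nonneg _)
  · intro p _; exact mul_nonneg (μ.nonneg _) (sq_nonneg _)
  · intro p _; exact le_of_eq (by ring)

theorem aux_trCov_nonneg {n k : ℕ} (μ : FinDist (Fin n → Fin k → ℝ)) (i : Fin n) :
    0 ≤ trCov μ i := by
  unfold trCov covFD
  refine Finset.sum_nonneg fun ℓ _ => ?_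
  rw [FinDist.exp]
  exact Finset.sum_nonneg fun x _ => mul_nonneg (μ.nonneg _) (mul_self_nonneg _)

/-- The purely numerical part of the argument. -/
theorem aux_num (n : ℕ) (hn : 1 ≤ n) (A C D : Fin n → Fin n → ℝ) (T : Fin n → ℝ)
    (hT : ∀ j, 0 ≤ T j) (hD : ∀ i j, 0 ≤ D i j) (hC : ∀ i j, C i j ^ 2 ≤ D i j * T j)
    (η : ℝ) (hη : ∑ j, T j ≤ n * η) :
    ∃ j, 0 ≤ ∑ i, (∑ j', A i j' ^ 2) * D i j ∧
      (∑ i, ∑ j, |A i j| * |C i j|) ^ 2 ≤ n ^ 2 * η * ∑ i, (∑ j', A i j' ^ 2) * D i j := by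
  have : Nonempty (Fin n) := ⟨⟨0, hn⟩⟩
  obtain ⟨j, -, hj⟩ := Finset.exists_max_image (Finset.univ : Finset (Fin n))
    (fun j => ∑ i, (∑ j', A i j' ^ 2) * D i j) Finset.univ_nonempty
  have hr : ∀ i, 0 ≤ ∑ j', A i j' ^ 2 := fun i => Finset.sum_nonneg fun _ _ => sq_nonneg _
  have hM : 0 ≤ ∑ i, (∑ j', A i j' ^ 2) * D i j :=
    Finset.sum_nonneg fun i _ => mul_nonneg (hr i) (hD i j)
  refine ⟨j, hM, ?_⟩
  have hn0 : (0 : ℝ) ≤ n := Nat.cast_nonneg n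
  calc (∑ i, ∑ j, |A i j| * |C i j|) ^ 2
      ≤ n * ∑ i, (∑ j, |A i j| * |C i j|) ^ 2 := by
        simpa using sq_sum_le_card_mul_sum_sq (s := (Finset.univ : Finset (Fin n)))
          (f := fun i => ∑ j, |A i j| * |C i j|)
    _ ≤ n * ∑ i, (∑ j', A i j' ^ 2) * ∑ j, D i j * T j := by
        gcongr with i _
        refine (Finset.sum_mul_sq_le_sq_mul_sq _ _ _).trans ?_
        simp_rw [sq_abs]
        gcongr with j' _
        exact hC i j'
    _ = n * ∑ j, T j * ∑ i, (∑ j', A i j' ^ 2) * D i j := by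
        congr 1
        simp_rw [Finset.mul_sum]
        rw [Finset.sum_comm]
        refine Finset.sum_congr rfl fun a _ => Finset.sum_congr rfl fun b _ => ?_
        ring
    _ ≤ n * ∑ j', T j' * ∑ i, (∑ j', A i j' ^ 2) * D i j := by
        refine mul_le_mul_of_nonneg_left (Finset.sum_le_sum fun j' _ => ?_) hn0
        exact mul_le_mul_of_nonneg_left (hj j' (Finset.mem_univ _)) (hT j')
    _ = n * ((∑ j', T j') * ∑ i, (∑ j', A i j' ^ 2) * D i j) := by rw [Finset.sum_mul]
    _ ≤ n * ((n * η) * ∑ i, (∑ j', A i j' ^ 2) * D i j) := by gcongr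
    _ = _ := by ring

/-- if the global correlation (weighted by `|A i j|`) is large,
then conditioning on some coordinate `x_j` decreases the average trace of the
covariance by at least `ε²/(ηk)` times the mean square of `A`. -/
theorem stmt_14 (n k : ℕ) (hn : 1 ≤ n) (hk : 1 ≤ k)
    (ε η : ℝ) (hε : 0 < ε) (hη : 0 < η)
    (μ : FinDist (Fin n → Fin k → ℝ))
    (hvar : (1 / (n : ℝ)) * ∑ i, trCov μ i ≤ η)
    (A : Fin n → Fin n → ℝ)
    (hA : 0 < ∑ i, ∑ j, A i j ^ 2)
    (hcorr : (1 / (n : ℝ) ^ 2) * ∑ i, ∑ j,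
        |A i j| * |∑ ℓ, covFD μ (fun x => x i ℓ) (fun x => x j ℓ)|
      ≥ ε * ((1 / (n : ℝ) ^ 2) * ∑ i, ∑ j, A i j ^ 2)) :
    ∃ j : Fin n,
      ∑ i, ((∑ j', A i j' ^ 2) / (∑ i', ∑ j', A i' j' ^ 2)) *
          (trCov μ i
            - ∑ z ∈ μ.supp.image (fun x => x j), probEq μ j z * condTrCov μ j z i)
        ≥ (ε ^ 2 / (η * k)) * ((1 / (n : ℝ) ^ 2) * ∑ i, ∑ j, A i j ^ 2) := by
  have hn0 : (0 : ℝ) < n := by exact_mod_cast hn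
  have hk1 : (1 : ℝ) ≤ k := by exact_mod_cast hk
  have hT : ∑ j, trCov μ j ≤ n * η := by
    rw [one_div, inv_mul_le_iff₀ hn0] at hvar
    exact hvar
  obtain ⟨j, hj0, hj⟩ := aux_num n hn A
    (fun i j => ∑ ℓ, covFD μ (fun x => x i ℓ) (fun x => x j ℓ))
    (fun i j => trCov μ i
            - ∑ z ∈ μ.supp.image (fun x => x j), probEq μ j z * condTrCov μ j z i)
    (trCov μ) (aux_trCov_nonneg μ)
    (fun i j => by
      rw [aux_drop]
      exact Finset.sum_nonneg fun ℓ _ => Finset.sum_nonneg fun x _ =>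
        mul_nonneg (μ.nonneg _) (sq_nonneg _))
    (aux_key μ) η hT
  refine ⟨j, ?_⟩
  simp_rw [div_mul_eq_mul_div]
  rw [← Finset.sum_div, ge_iff_le, le_div_iff₀ hA]
  set S := ∑ i, ∑ j, A i j ^ 2
  set M := ∑ i, (∑ j', A i j' ^ 2) * (trCov μ i
            - ∑ z ∈ μ.supp.image (fun x => x j), probEq μ j z * condTrCov μ j z i)
  have hc : ε * S ≤ ∑ i, ∑ j,
        |A i j| * |∑ ℓ, covFD μ (fun x => x i ℓ) (fun x => x j ℓ)| := by
    have hp : (0 : ℝ) < 1 / (n : ℝ) ^ 2 := by positivity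
    refine le_of_mul_le_mul_left ?_ hp
    linarith
  have h1 : (ε * S) ^ 2 ≤ n ^ 2 * η * M :=
    (pow_le_pow_left₀ (by positivity) hc 2).trans hj
  have h2 : (ε * S) ^ 2 ≤ n ^ 2 * η * M * k :=
    h1.trans (le_mul_of_one_le_right (by positivity) hk1)
  have h3 : ε ^ 2 * (1 * S / (n : ℝ) ^ 2) / (η * k) * S = (ε * S) ^ 2 / (n ^ 2 * η * k) := by
    field_simp
  rw [h3, div_le_iff₀ (by positivity)]
  linarith
end
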